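/- arXiv:0907.5232 — 3 statements merged into one kernel-verified Lean document; each statement's English description precedes it below -/
import Mathlib

section
/- The n-th Ramanujan prime satisfies R_n ∼ 2n·log n as n → ∞, i.e., the ratio R_n / (2n·log n) tends to 1 as n → ∞. -/
/-- The `n`-th Ramanujan prime: the smallest positive integer `R` such that for every
integer `x ≥ R` we have `π(x) − π(x/2) ≥ n`, where `π` counts primes and `x/2`
is `⌊x/2⌋`. -/
noncomputable def ramanujan (n : ℕ) : ℕ :=
  sInf {R : ℕ | 0 < R ∧ ∀ x : ℕ, R ≤ x → n ≤ x.primeCounting - (x / 2).primeCounting}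

open MeasureTheory Filter Topology

/-- The Fejér kernel on the real line, normalised to take the value `1` at the origin. -/
noncomputable def fejer (x : ℝ) : ℝ := Real.sinc (x / 2) ^ 2

lemma fejer_nonneg (x : ℝ) : 0 ≤ fejer x := sq_nonneg _

lemma continuous_fejer : Continuous fejer := by
  unfold fejer
  exact (Real.continuous_sinc.comp (continuous_id.div_const 2)).pow 2

lemma fejer_mul_sq (x : ℝ) : fejer x * x ^ 2 = 4 * Real.sin (x / 2) ^ 2 := by
  unfold fejer
  rcases eq_or_ne x 0 with rfl | hx
  · simp
  · rw [Real.sinc_of_ne_zero (by simpa using hx)]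
    field_simp
    ring

lemma fejer_le_one (x : ℝ) : fejer x ≤ 1 :=
  (sq_le_one_iff_abs_le_one _).2 (Real.abs_sinc_le_one _)

lemma integrable_fejer : Integrable fejer := by
  refine (integrable_inv_one_add_sq.const_mul 5).mono' continuous_fejer.aestronglyMeasurable
    (.of_forall fun x => ?_)
  rw [Real.norm_of_nonneg (fejer_nonneg x), ← div_eq_mul_inv, le_div_iff₀ (by positivity)]
  nlinarith [fejer_mul_sq x, fejer_le_one x, Real.sin_sq_le_one (x / 2)]

lemma integral_fejer_pos : 0 < ∫ x, fejer x :=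
  integral_pos_of_integrable_nonneg_nonzero (x := 0) continuous_fejer integrable_fejer
    fejer_nonneg (by simp [fejer])

lemma integral_one_sub_div_mul_exp {T : ℝ} (hT : 0 < T) {a : ℂ} (ha : a ≠ 0) :
    ∫ y in (0 : ℝ)..T, ((1 - y / T : ℝ) : ℂ) * Complex.exp (a * y) =
      (Complex.exp (a * T) - 1) / (T * a ^ 2) - 1 / a := by
  have hT' : (T : ℂ) ≠ 0 := by exact_mod_cast hT.ne'
  have hd (y : ℝ) : HasDerivAt (fun y : ℝ => ((1 - y / T : ℝ) : ℂ) * (Complex.exp (a * y) / a) +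
      Complex.exp (a * y) / (T * a ^ 2)) (((1 - y / T : ℝ) : ℂ) * Complex.exp (a * y)) y := by
    have he : HasDerivAt (fun y : ℝ => Complex.exp (a * y)) (Complex.exp (a * y) * (a * 1)) y :=
      (((hasDerivAt_id y).ofReal_comp).const_mul a).cexp
    have hl : HasDerivAt (fun y : ℝ => ((1 - y / T : ℝ) : ℂ)) ((-(1 / T) : ℝ) : ℂ) y :=
      (((hasDerivAt_id y).div_const T).const_sub 1).ofReal_comp
    convert! (hl.mul (he.div_const a)).add (he.div_const (T * a ^ 2)) using 1
    push_cast
    field_simp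
    ring
  rw [intervalIntegral.integral_eq_sub_of_hasDerivAt (fun y _ => hd y)
    (Continuous.intervalIntegrable (by fun_prop) _ _)]
  simp only [div_self hT.ne', sub_self, Complex.ofReal_zero, mul_zero, zero_div, sub_zero,
    Complex.exp_zero, Complex.ofReal_one]
  ring

lemma integral_triangle_mul_exp {T : ℝ} (hT : 0 < T) (w : ℝ) :
    ∫ y in (-T)..T, ((1 - |y| / T : ℝ) : ℂ) * Complex.exp (Complex.I * w * y) =
      ((T * fejer (T * w) : ℝ) : ℂ) := by
  have hc : Continuous fun y : ℝ => ((1 - |y| / T : ℝ) : ℂ) * Complex.exp (Complex.I * w * y) := by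
    fun_prop
  have hpos (w : ℝ) : ∫ y in (0 : ℝ)..T, ((1 - |y| / T : ℝ) : ℂ) * Complex.exp (Complex.I * w * y)
      = ∫ y in (0 : ℝ)..T, ((1 - y / T : ℝ) : ℂ) * Complex.exp (Complex.I * w * y) := by
    refine intervalIntegral.integral_congr fun y hy => ?_
    rw [Set.uIcc_of_le hT.le] at hy
    simp only [abs_of_nonneg hy.1]
  have hneg : ∫ y in (-T)..0, ((1 - |y| / T : ℝ) : ℂ) * Complex.exp (Complex.I * w * y)
      = ∫ y in (0 : ℝ)..T, ((1 - |y| / T : ℝ) : ℂ) * Complex.exp (Complex.I * (-w : ℝ) * y) := by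
    have h := intervalIntegral.integral_comp_neg (a := 0) (b := T)
      (fun y : ℝ => ((1 - |y| / T : ℝ) : ℂ) * Complex.exp (Complex.I * w * y))
    rw [neg_zero] at h
    rw [← h]
    simp
  rw [← intervalIntegral.integral_add_adjacent_intervals (hc.intervalIntegrable (-T) 0)
    (hc.intervalIntegrable 0 T), hneg, hpos, hpos]
  have hT' : (T : ℂ) ≠ 0 := by exact_mod_cast hT.ne'
  rcases eq_or_ne w 0 with rfl | hw
  · have h1 : ∫ y in (0 : ℝ)..T, (1 - y / T) = T / 2 := by
      rw [intervalIntegral.integral_sub (Continuous.intervalIntegrable (by fun_prop) _ _)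
        (Continuous.intervalIntegrable (by fun_prop) _ _), intervalIntegral.integral_div]
      simp
      field_simp
      norm_num
    simp only [neg_zero, Complex.ofReal_zero, mul_zero, zero_mul, Complex.exp_zero, mul_one]
    rw [intervalIntegral.integral_ofReal, h1]
    simp [fejer]
  · have hw' : (w : ℂ) ≠ 0 := by exact_mod_cast hw
    rw [integral_one_sub_div_mul_exp hT (by simp [hw]), integral_one_sub_div_mul_exp hT (by simp [hw])]
    have hf : T * fejer (T * w) = 2 * (1 - Real.cos (T * w)) / (T * w ^ 2) := by
      have h2 := fejer_mul_sq (T * w)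
      have h3 : Real.cos (T * w) = 1 - 2 * Real.sin (T * w / 2) ^ 2 := by
        rw [Real.sin_sq_eq_half_sub]; ring_nf
      rw [eq_div_iff (by positivity)]
      rw [h3]
      linear_combination h2
    rw [hf]
    push_cast
    rw [Complex.cos]
    have e1 : Complex.I * w * T = T * w * Complex.I := by ring
    have e2 : Complex.I * -w * T = -(T * w) * Complex.I := by ring
    rw [e1, e2]
    field_simp
    ring_nf
    simp

section Fourier

variable {h : ℝ → ℝ} {B T : ℝ} {G : ℂ → ℂ}

lemma integral_triangle_mul_laplace (hm : Measurable h) (hB : ∀ u, |h u| ≤ B)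
    (hG : ∀ z : ℂ, 0 < z.re → ∫ u in Set.Ioi (0 : ℝ), (h u : ℂ) * Complex.exp (-z * u) = G z)
    (hT : 0 < T) (v : ℝ) {δ : ℝ} (hδ : 0 < δ) :
    ∫ y in (-T)..T, ((1 - |y| / T : ℝ) : ℂ) * Complex.exp (Complex.I * v * y) *
        G (δ + Complex.I * y) =
      ((∫ u in Set.Ioi (0 : ℝ), h u * (T * fejer (T * (v - u))) * Real.exp (-δ * u) : ℝ) : ℂ) := by
  have hexp : IntegrableOn (fun u : ℝ => h u * Real.exp (-δ * u)) (Set.Ioi 0) :=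
    (exp_neg_integrableOn_Ioi 0 hδ).bdd_mul hm.aestronglyMeasurable (.of_forall hB)
  have htri : IntervalIntegrable (fun y : ℝ => ((1 - |y| / T : ℝ) : ℂ)) volume (-T) T :=
    Continuous.intervalIntegrable (by fun_prop) _ _
  have hprod : Integrable (Function.uncurry fun (y u : ℝ) =>
      Complex.exp (((v - u) * y : ℝ) * Complex.I) *
        (((1 - |y| / T : ℝ) : ℂ) * ((h u * Real.exp (-δ * u) : ℝ) : ℂ)))
      ((volume.restrict (Set.uIoc (-T) T)).prod (volume.restrict (Set.Ioi 0))) := by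
    refine ((htri.def').mul_prod hexp.ofReal).bdd_mul (c := 1)
      (Continuous.aestronglyMeasurable (by fun_prop)) (.of_forall fun p => ?_)
    rw [Complex.norm_exp_ofReal_mul_I]
  calc
    _ = ∫ y in (-T)..T, ∫ u in Set.Ioi (0 : ℝ), Complex.exp (((v - u) * y : ℝ) * Complex.I) *
        (((1 - |y| / T : ℝ) : ℂ) * ((h u * Real.exp (-δ * u) : ℝ) : ℂ)) := by
      refine intervalIntegral.integral_congr fun y _ => ?_
      rw [← hG _ (by simpa using hδ), ← integral_const_mul]
      refine integral_congr_ae (.of_forall fun u => ?_)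
      simp only
      have e : Complex.exp (Complex.I * v * y) * Complex.exp (-(δ + Complex.I * y) * u) =
          Complex.exp (((v - u) * y : ℝ) * Complex.I) * Complex.exp (-δ * u) := by
        rw [← Complex.exp_add, ← Complex.exp_add]
        congr 1
        push_cast
        ring
      push_cast at e ⊢
      linear_combination (1 - |y| / T : ℂ) * h u * e
    _ = ∫ u in Set.Ioi (0 : ℝ), ∫ y in (-T)..T, Complex.exp (((v - u) * y : ℝ) * Complex.I) *
        (((1 - |y| / T : ℝ) : ℂ) * ((h u * Real.exp (-δ * u) : ℝ) : ℂ)) :=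
      intervalIntegral_integral_swap hprod
    _ = _ := by
      rw [← integral_complex_ofReal]
      refine integral_congr_ae (.of_forall fun u => ?_)
      have e := integral_triangle_mul_exp hT (v - u)
      have e' : ((h u * (T * fejer (T * (v - u))) * Real.exp (-δ * u) : ℝ) : ℂ) =
          (h u * Real.exp (-δ * u) : ℝ) * ((T * fejer (T * (v - u)) : ℝ) : ℂ) := by
        push_cast
        ring
      beta_reduce
      rw [e']
      rw [← e, ← intervalIntegral.integral_const_mul]
      refine intervalIntegral.integral_congr fun y _ => ?_
      have e2 : (((v - u) * y : ℝ) : ℂ) * Complex.I = Complex.I * ((v - u : ℝ) : ℂ) * y := by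
        push_cast
        ring
      rw [e2]
      ring

lemma integrable_fejer_comp (hT : 0 < T) (v : ℝ) :
    Integrable fun u => T * fejer (T * (v - u)) :=
  ((integrable_fejer.comp_mul_left' hT.ne').comp_sub_left v).const_mul T

lemma integral_triangle_mul_boundary (hm : Measurable h) (hB : ∀ u, |h u| ≤ B)
    (hc : ContinuousOn G {z | 0 ≤ z.re})
    (hG : ∀ z : ℂ, 0 < z.re → ∫ u in Set.Ioi (0 : ℝ), (h u : ℂ) * Complex.exp (-z * u) = G z)
    (hT : 0 < T) (v : ℝ) :
    ∫ y in (-T)..T, ((1 - |y| / T : ℝ) : ℂ) * Complex.exp (Complex.I * v * y) *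
        G (Complex.I * y) =
      ((∫ u in Set.Ioi (0 : ℝ), h u * (T * fejer (T * (v - u))) : ℝ) : ℂ) := by
  have hR : Tendsto (fun δ : ℝ =>
      ∫ u in Set.Ioi (0 : ℝ), h u * (T * fejer (T * (v - u))) * Real.exp (-δ * u)) (𝓝[>] 0)
      (𝓝 (∫ u in Set.Ioi (0 : ℝ), h u * (T * fejer (T * (v - u))))) := by
    have hK : Measurable fun u => h u * (T * fejer (T * (v - u))) := by
      have := continuous_fejer.measurable
      fun_prop
    refine tendsto_integral_filter_of_dominated_convergence
      (fun u => B * (T * fejer (T * (v - u)))) (.of_forall fun δ => ?_) ?_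
      ((integrable_fejer_comp hT v).const_mul B).integrableOn (.of_forall fun u => ?_)
    · exact (hK.mul (by fun_prop)).aestronglyMeasurable
    · filter_upwards [self_mem_nhdsWithin] with δ hδ
      refine (ae_restrict_mem measurableSet_Ioi).mono fun u hu => ?_
      have h0 : 0 ≤ T * fejer (T * (v - u)) := mul_nonneg hT.le (fejer_nonneg _)
      rw [norm_mul, norm_mul, Real.norm_of_nonneg h0, Real.norm_of_nonneg (Real.exp_nonneg _)]
      have h1 : Real.exp (-δ * u) ≤ 1 :=
        Real.exp_le_one_iff.2 (by nlinarith [mul_pos (Set.mem_Ioi.1 hδ) (Set.mem_Ioi.1 hu)])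
      calc _ ≤ ‖h u‖ * (T * fejer (T * (v - u))) * 1 := by gcongr
        _ ≤ _ := by rw [mul_one]; gcongr; exact hB u
    · have : Continuous fun δ : ℝ => h u * (T * fejer (T * (v - u))) * Real.exp (-δ * u) := by
        fun_prop
      simpa using (this.tendsto 0).mono_left nhdsWithin_le_nhds
  have hcont {δ : ℝ} (hδ : 0 ≤ δ) : Continuous fun y : ℝ => G (δ + Complex.I * y) :=
    hc.comp_continuous (by fun_prop) fun y => by simpa using hδ
  obtain ⟨M, hM⟩ := ((isCompact_Icc (a := (0 : ℝ)) (b := 1)).prod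
    (isCompact_Icc (a := -T) (b := T))).exists_bound_of_continuousOn
    (f := fun p : ℝ × ℝ => G (p.1 + Complex.I * p.2))
    (hc.comp (by fun_prop) fun p hp => by simpa using hp.1.1)
  have hL : Tendsto (fun δ : ℝ => ∫ y in (-T)..T, ((1 - |y| / T : ℝ) : ℂ) *
      Complex.exp (Complex.I * v * y) * G (δ + Complex.I * y)) (𝓝[>] 0)
      (𝓝 (∫ y in (-T)..T, ((1 - |y| / T : ℝ) : ℂ) * Complex.exp (Complex.I * v * y) *
        G (Complex.I * y))) := by
    refine intervalIntegral.tendsto_integral_filter_of_dominated_convergence (fun _ => M) ?_ ?_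
      intervalIntegrable_const (.of_forall fun y _ => ?_)
    · filter_upwards [self_mem_nhdsWithin] with δ hδ
      have := hcont (Set.mem_Ioi.1 hδ).le
      exact (Continuous.mul (by fun_prop) this).aestronglyMeasurable
    · filter_upwards [Ioo_mem_nhdsGT one_pos] with δ hδ
      refine .of_forall fun y hy => ?_
      rw [Set.uIoc_of_le (by linarith)] at hy
      have e : Complex.I * v * y = ((v * y : ℝ) : ℂ) * Complex.I := by
        push_cast
        ring
      have h1 : |1 - |y| / T| ≤ 1 := by
        have h2 : |y| / T ≤ 1 := (div_le_one hT).2 (abs_le.2 ⟨hy.1.le, hy.2⟩)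
        rw [abs_of_nonneg (by linarith)]
        linarith [show 0 ≤ |y| / T by positivity]
      rw [norm_mul, norm_mul, e, Complex.norm_exp_ofReal_mul_I, mul_one, Complex.norm_real,
        Real.norm_eq_abs]
      exact (mul_le_of_le_one_left (norm_nonneg _) h1).trans
        (hM (δ, y) ⟨⟨hδ.1.le, hδ.2.le⟩, ⟨hy.1.le, hy.2⟩⟩)
    · refine Tendsto.const_mul _ ?_
      have h0 : ContinuousWithinAt G {z | 0 ≤ z.re} (Complex.I * y) := hc _ (by simp)
      refine h0.tendsto.comp (tendsto_nhdsWithin_iff.2 ⟨?_, ?_⟩)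
      · have : Continuous fun δ : ℝ => (δ : ℂ) + Complex.I * y := by fun_prop
        simpa using (this.tendsto 0).mono_left nhdsWithin_le_nhds
      · filter_upwards [self_mem_nhdsWithin] with δ hδ
        simpa using (Set.mem_Ioi.1 hδ).le
  refine tendsto_nhds_unique (hL.congr' ?_)
    ((Complex.continuous_ofReal.tendsto _).comp hR)
  filter_upwards [self_mem_nhdsWithin] with δ hδ
  exact integral_triangle_mul_laplace hm hB hG hT v hδ

lemma tendsto_integral_mul_fejer (hm : Measurable h) (hB : ∀ u, |h u| ≤ B)
    (hc : ContinuousOn G {z | 0 ≤ z.re})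
    (hG : ∀ z : ℂ, 0 < z.re → ∫ u in Set.Ioi (0 : ℝ), (h u : ℂ) * Complex.exp (-z * u) = G z)
    (hT : 0 < T) :
    Tendsto (fun v => ∫ u in Set.Ioi (0 : ℝ), h u * (T * fejer (T * (v - u)))) atTop (𝓝 0) := by
  have hrl := Real.tendsto_integral_exp_smul_cocompact
    ((Set.Ioc (-T) T).indicator fun y : ℝ => ((1 - |y| / T : ℝ) : ℂ) * G (Complex.I * y))
  have hv : Tendsto (fun v : ℝ => -(v / (2 * Real.pi))) atTop (cocompact ℝ) :=
    (tendsto_neg_atTop_atBot.comp (tendsto_id.atTop_div_const Real.two_pi_pos)).mono_right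
      atBot_le_cocompact
  have := (Complex.continuous_re.tendsto _).comp (hrl.comp hv)
  refine this.congr fun v => ?_
  simp only [Function.comp_apply]
  rw [← Complex.ofReal_re (∫ u in Set.Ioi (0 : ℝ), h u * (T * fejer (T * (v - u)))),
    ← integral_triangle_mul_boundary hm hB hc hG hT v,
    intervalIntegral.integral_of_le (by linarith), ← integral_indicator measurableSet_Ioc]
  congr 2 with y
  by_cases hy : y ∈ Set.Ioc (-T) T
  · rw [Set.indicator_of_mem hy, Set.indicator_of_mem hy, Circle.smul_def, Real.fourierChar_apply,
      smul_eq_mul]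
    have e : ((2 * Real.pi * -(y * -(v / (2 * Real.pi))) : ℝ) : ℂ) * Complex.I =
        Complex.I * v * y := by
      have : 2 * Real.pi * -(y * -(v / (2 * Real.pi))) = v * y := by
        field_simp
      rw [this]
      push_cast
      ring
    rw [e]
    ring
  · rw [Set.indicator_of_notMem hy, Set.indicator_of_notMem hy, smul_zero]

end Fourier

lemma exists_le_integral_mul_fejer {ε η : ℝ} (B : ℝ) (hε : 0 < ε) (hη : 0 < η) :
    ∃ T > 0, ∃ c > 0, ∀ (g : ℝ → ℝ) (m : ℝ), Measurable g → (∀ u, |g u| ≤ B) →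
      (∀ u, |u - m| ≤ η → ε ≤ g u) → c ≤ ∫ u, g u * (T * fejer (T * (m - u))) := by
  have hJ := integral_fejer_pos
  set J := ∫ x, fejer x with hJdef
  have hlim : Tendsto (fun T : ℝ => (ε + B) * (∫ x in (-(T * η))..(T * η), fejer x) - B * J) atTop
      (𝓝 ((ε + B) * J - B * J)) := by
    refine ((intervalIntegral_tendsto_integral integrable_fejer ?_ ?_).const_mul _).sub_const _
    · exact tendsto_neg_atTop_atBot.comp (tendsto_id.atTop_mul_const hη)
    · exact tendsto_id.atTop_mul_const hη
  have hlt : ε * J / 2 < (ε + B) * J - B * J := by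
    have := mul_pos hε hJ
    linarith
  obtain ⟨T, hTlt, hT⟩ := ((hlim.eventually_const_lt hlt).and (eventually_gt_atTop 0)).exists
  refine ⟨T, hT, ε * J / 2, by positivity, fun g m hg hB hge => hTlt.le.trans ?_⟩
  have hK : Integrable fun x => T * fejer (T * x) :=
    (integrable_fejer.comp_mul_left' hT.ne').const_mul T
  have hKJ : ∫ x, T * fejer (T * x) = J := by
    rw [integral_const_mul, Measure.integral_comp_mul_left, abs_of_pos (inv_pos.2 hT), smul_eq_mul,
      mul_inv_cancel_left₀ hT.ne']
  have hKη : ∫ x in Set.Ioc (-η) η, T * fejer (T * x) = ∫ x in (-(T * η))..(T * η), fejer x := by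
    rw [← intervalIntegral.integral_of_le (by linarith), intervalIntegral.integral_const_mul,
      intervalIntegral.mul_integral_comp_mul_left, mul_neg]
  have hsub := integral_sub_left_eq_self (fun x => g (m - x) * (T * fejer (T * x))) volume m
  simp only [sub_sub_cancel] at hsub
  rw [hsub, ← hKη, ← hKJ, ← integral_indicator measurableSet_Ioc, ← integral_const_mul,
    ← integral_const_mul, ← integral_sub ((hK.indicator measurableSet_Ioc).const_mul _)
      (hK.const_mul _)]
  refine integral_mono (((hK.indicator measurableSet_Ioc).const_mul _).sub (hK.const_mul _))
    (hK.bdd_mul (c := B) (hg.comp (by fun_prop)).aestronglyMeasurable (.of_forall fun x => hB _)) fun x => ?_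
  have h0 : 0 ≤ T * fejer (T * x) := mul_nonneg hT.le (fejer_nonneg _)
  by_cases hx : x ∈ Set.Ioc (-η) η
  · have h1 : ε ≤ g (m - x) := hge _ (abs_le.2 ⟨by linarith [hx.2], by linarith [hx.1]⟩)
    simp only [Set.indicator_of_mem hx]
    nlinarith
  · have h1 := (abs_le.1 (hB (m - x))).1
    simp only [Set.indicator_of_notMem hx]
    nlinarith

lemma tendsto_zero_of_tendsto_integral_mul_fejer {h : ℝ → ℝ} {B : ℝ} (hm : Measurable h)
    (hB : ∀ u, |h u| ≤ B) (hmono : Monotone fun u => Real.exp u * (h u + 1))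
    (hconv : ∀ T > 0, Tendsto (fun v => ∫ u in Set.Ioi (0 : ℝ), h u * (T * fejer (T * (v - u))))
      atTop (𝓝 0)) :
    Tendsto h atTop (𝓝 0) := by
  have hind (T v : ℝ) : ∫ u in Set.Ioi (0 : ℝ), h u * (T * fejer (T * (v - u))) =
      ∫ u, (Set.Ioi (0 : ℝ)).indicator h u * (T * fejer (T * (v - u))) := by
    rw [← integral_indicator measurableSet_Ioi]
    congr 1 with u
    rw [Set.indicator_mul_left]
  have hgm : Measurable ((Set.Ioi (0 : ℝ)).indicator h) := hm.indicator measurableSet_Ioi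
  have hgB (u : ℝ) : |(Set.Ioi (0 : ℝ)).indicator h u| ≤ B :=
    (norm_indicator_le_norm_self h u).trans (hB u)
  have hle {u v : ℝ} (huv : u ≤ v) : h u + 1 ≤ Real.exp (v - u) * (h v + 1) := by
    have := hmono huv
    simp only at this
    rw [Real.exp_sub, div_mul_eq_mul_div, le_div_iff₀ (Real.exp_pos u)]
    linarith
  have hB0 (u : ℝ) : 0 ≤ h u + 1 := by
    have h1 : Tendsto (fun t : ℝ => Real.exp t * (B + 1)) atBot (𝓝 0) := by
      simpa using Real.tendsto_exp_atBot.mul_const (B + 1)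
    have h2 : Tendsto (fun t : ℝ => Real.exp t * (-B + 1)) atBot (𝓝 0) := by
      simpa using Real.tendsto_exp_atBot.mul_const (-B + 1)
    have h3 : 0 ≤ Real.exp u * (h u + 1) := by
      refine le_of_tendsto h2 ?_
      filter_upwards [eventually_le_atBot u] with t ht
      refine le_trans ?_ (hmono ht)
      have := (abs_le.1 (hB t)).1
      simp only
      gcongr
    exact (mul_nonneg_iff_of_pos_left (Real.exp_pos u)).1 h3
  rw [Metric.tendsto_nhds]
  intro ε hε
  obtain ⟨η, ⟨hη1, hη2⟩, hη⟩ : ∃ η : ℝ, (1 + ε / 2 < (1 + ε) * Real.exp (-(2 * η)) ∧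
      (1 - ε) * Real.exp (2 * η) < 1 - ε / 2) ∧ 0 < η := by
    have c1 : Continuous fun η : ℝ => (1 + ε) * Real.exp (-(2 * η)) := by fun_prop
    have c2 : Continuous fun η : ℝ => (1 - ε) * Real.exp (2 * η) := by fun_prop
    have e1 := (c1.tendsto 0).eventually_const_lt (u := 1 + ε / 2) (by simp; linarith)
    have e2 := (c2.tendsto 0).eventually_lt_const (u := 1 - ε / 2) (by simp; linarith)
    exact (((e1.and e2).filter_mono nhdsWithin_le_nhds).and
      (self_mem_nhdsWithin (s := Set.Ioi (0 : ℝ)))).exists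
  obtain ⟨T, hT, c, hc, hlow⟩ := exists_le_integral_mul_fejer B (half_pos hε) hη
  have hsmall := (Metric.tendsto_nhds.1 (hconv T hT)) c hc
  filter_upwards [(tendsto_atTop_add_const_right _ η tendsto_id).eventually hsmall,
    (tendsto_atTop_add_const_right _ (-η) tendsto_id).eventually hsmall,
    eventually_gt_atTop (2 * η)] with v h1 h2 hv
  simp only [id, Real.dist_eq, sub_zero, hind] at h1 h2 ⊢
  rw [abs_lt] at h1 h2 ⊢
  constructor
  · by_contra! hcon
    refine absurd h2.1 (not_lt.2 ?_)
    have := hlow (fun u => -(Set.Ioi (0 : ℝ)).indicator h u) (v + -η) hgm.neg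
      (fun u => by simpa using hgB u) fun u hu => ?_
    · simp only [neg_mul, integral_neg] at this
      linarith
    · rw [abs_le] at hu
      have hu0 : u ∈ Set.Ioi (0 : ℝ) := Set.mem_Ioi.2 (by linarith)
      rw [Set.indicator_of_mem hu0]
      have h3 := hle (show u ≤ v by linarith)
      have h4 : Real.exp (v - u) ≤ Real.exp (2 * η) := Real.exp_le_exp.2 (by linarith)
      nlinarith [hB0 v, Real.exp_pos (v - u), mul_le_mul_of_nonneg_right h4 (hB0 v),
        Real.exp_pos (2 * η)]
  · by_contra! hcon
    refine absurd h1.2 (not_lt.2 (hlow _ (v + η) hgm hgB fun u hu => ?_))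
    rw [abs_le] at hu
    have hu0 : u ∈ Set.Ioi (0 : ℝ) := Set.mem_Ioi.2 (by linarith)
    rw [Set.indicator_of_mem hu0]
    have h3 := hle (show v ≤ u by linarith)
    have h4 : Real.exp (u - v) ≤ Real.exp (2 * η) := Real.exp_le_exp.2 (by linarith)
    rw [Real.exp_neg, ← div_eq_mul_inv, lt_div_iff₀ (Real.exp_pos _)] at hη1
    have h5 := mul_le_mul_of_nonneg_right h4 (hB0 u)
    have h6 : (1 + ε / 2) * Real.exp (2 * η) ≤ (h u + 1) * Real.exp (2 * η) := by linarith
    linarith [le_of_mul_le_mul_right h6 (Real.exp_pos _)]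

section PrimeNumberTheorem

open ArithmeticFunction ArithmeticFunction.vonMangoldt Chebyshev

lemma LSeries_vonMangoldt_eq_aux_add {s : ℂ} (hs : 1 < s.re) :
    LSeries (fun n => (vonMangoldt n : ℂ)) s =
      LFunctionResidueClassAux (1 : ZMod 1) s + 1 / (s - 1) := by
  have h := eqOn_LFunctionResidueClassAux (q := 1) (a := (1 : ZMod 1)) isUnit_one hs
  have hres : residueClass (1 : ZMod 1) = fun n => vonMangoldt n := by
    ext n
    have hn : n ∈ {n : ℕ | (n : ZMod 1) = 1} := Subsingleton.elim (n : ZMod 1) 1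
    exact Set.indicator_of_mem hn fun n => vonMangoldt n
  rw [h]
  simp [hres]

lemma psi_exp_mul_exp_neg_le (u : ℝ) : psi (Real.exp u) * Real.exp (-u) ≤ Real.log 4 + 4 := by
  rw [Real.exp_neg, ← div_eq_mul_inv, div_le_iff₀ (Real.exp_pos u)]
  exact psi_le_const_mul_self (Real.exp_nonneg u)

lemma integral_psi_exp_mul_exp {z : ℂ} (hz : 0 < z.re) :
    LSeries (fun n => (vonMangoldt n : ℂ)) (1 + z) = (1 + z) *
      ∫ u in Set.Ioi (0 : ℝ), ((psi (Real.exp u) * Real.exp (-u) : ℝ) : ℂ) *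
        Complex.exp (-z * u) := by
  have hO : (fun n : ℕ => ∑ k ∈ Finset.Icc 1 n, vonMangoldt k) =O[atTop] fun n => (n : ℝ) ^ (1 : ℝ) := by
    refine Asymptotics.isBigO_of_le' (c := Real.log 4 + 4) _ fun n => ?_
    have h := psi_le_const_mul_self (Nat.cast_nonneg (α := ℝ) n)
    have h0 := psi_nonneg (n : ℝ)
    have e : ∑ k ∈ Finset.Icc 1 n, vonMangoldt k = psi n := by
      rw [psi, Nat.floor_natCast]
      rfl
    rw [e, Real.rpow_one, Real.norm_of_nonneg h0, Real.norm_of_nonneg (Nat.cast_nonneg n)]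
    exact h
  rw [LSeries_eq_mul_integral_of_nonneg (fun n => vonMangoldt n) zero_le_one (by simpa using hz) hO
    fun n => vonMangoldt_nonneg]
  congr 1
  have himg : Real.exp '' Set.Ioi 0 = Set.Ioi 1 := by
    ext x
    simp only [Set.mem_image, Set.mem_Ioi]
    constructor
    · rintro ⟨u, hu, rfl⟩
      exact Real.one_lt_exp_iff.2 hu
    · intro hx
      exact ⟨Real.log x, Real.log_pos hx, Real.exp_log (by linarith)⟩
  rw [← himg, integral_image_eq_integral_abs_deriv_smul measurableSet_Ioi
    (fun u _ => (Real.hasDerivAt_exp u).hasDerivWithinAt) Real.exp_injective.injOn]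
  refine integral_congr_ae (.of_forall fun u => ?_)
  beta_reduce
  have e : ∑ k ∈ Finset.Icc 1 ⌊Real.exp u⌋₊, (vonMangoldt k : ℂ) = (psi (Real.exp u) : ℂ) := by
    rw [psi]
    push_cast
    rfl
  rw [e, abs_of_pos (Real.exp_pos u), Complex.real_smul,
    Complex.cpow_def_of_ne_zero (by exact_mod_cast (Real.exp_pos u).ne'),
    ← Complex.ofReal_log (Real.exp_nonneg u), Real.log_exp]
  push_cast
  rw [mul_left_comm, ← Complex.exp_add, mul_assoc, ← Complex.exp_add]
  ring_nf

lemma integral_psi_exp_sub_one {z : ℂ} (hz : 0 < z.re) :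
    ∫ u in Set.Ioi (0 : ℝ), ((psi (Real.exp u) * Real.exp (-u) - 1 : ℝ) : ℂ) *
        Complex.exp (-z * u) = (LFunctionResidueClassAux (1 : ZMod 1) (1 + z) - 1) / (1 + z) := by
  have hz0 : z ≠ 0 := by
    rintro rfl
    simp at hz
  have hz1 : 1 + z ≠ 0 := by
    intro h
    have := congrArg Complex.re h
    simp at this
    linarith
  have hre : (-z).re < 0 := by simpa using hz
  have hexp := integrableOn_exp_mul_complex_Ioi hre 0
  have hmeas : Measurable fun u : ℝ => ((psi (Real.exp u) * Real.exp (-u) : ℝ) : ℂ) := by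
    have := psi_mono.measurable
    fun_prop
  have hpsiInt : IntegrableOn (fun u : ℝ => ((psi (Real.exp u) * Real.exp (-u) : ℝ) : ℂ) *
      Complex.exp (-z * u)) (Set.Ioi 0) := by
    refine hexp.bdd_mul (c := Real.log 4 + 4) hmeas.aestronglyMeasurable (.of_forall fun u => ?_)
    rw [Complex.norm_real, Real.norm_of_nonneg (mul_nonneg (psi_nonneg _) (Real.exp_nonneg _))]
    exact psi_exp_mul_exp_neg_le u
  simp only [Complex.ofReal_sub, Complex.ofReal_one, sub_mul, one_mul]
  rw [integral_sub hpsiInt hexp, integral_exp_mul_complex_Ioi hre]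
  have h1 := integral_psi_exp_mul_exp hz
  rw [LSeries_vonMangoldt_eq_aux_add (by simpa using hz), add_sub_cancel_left] at h1
  rw [eq_div_iff hz1, sub_mul, mul_comm, ← h1]
  simp
  field_simp
  ring

lemma tendsto_psi_div : Tendsto (fun x => psi x / x) atTop (𝓝 1) := by
  have hm : Measurable fun u : ℝ => psi (Real.exp u) * Real.exp (-u) - 1 := by
    have := psi_mono.measurable
    fun_prop
  have hB (u : ℝ) : |psi (Real.exp u) * Real.exp (-u) - 1| ≤ Real.log 4 + 4 := by
    have h1 := psi_exp_mul_exp_neg_le u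
    have h2 : 0 ≤ psi (Real.exp u) * Real.exp (-u) := mul_nonneg (psi_nonneg _) (Real.exp_nonneg _)
    have h3 : 0 ≤ Real.log 4 := Real.log_nonneg (by norm_num)
    rw [abs_le]
    constructor <;> linarith
  have hc : ContinuousOn (fun z => (LFunctionResidueClassAux (1 : ZMod 1) (1 + z) - 1) / (1 + z))
      {z : ℂ | 0 ≤ z.re} := by
    refine ContinuousOn.div (ContinuousOn.sub ?_ continuousOn_const) (by fun_prop) fun z hz h => ?_
    · exact (continuousOn_LFunctionResidueClassAux (1 : ZMod 1)).comp (by fun_prop)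
        fun z hz => by simpa using hz
    · have := congrArg Complex.re h
      have hz' : 0 ≤ z.re := hz
      simp at this
      linarith
  have hlim := tendsto_zero_of_tendsto_integral_mul_fejer hm hB ?_ fun T hT =>
    tendsto_integral_mul_fejer hm hB hc (fun z hz => integral_psi_exp_sub_one hz) hT
  · have h := (hlim.comp Real.tendsto_log_atTop).add_const 1
    rw [zero_add] at h
    refine h.congr' ?_
    filter_upwards [eventually_gt_atTop 0] with x hx
    simp only [Function.comp_apply, Real.exp_neg, Real.exp_log hx]
    ring
  · have e (u : ℝ) : Real.exp u * (psi (Real.exp u) * Real.exp (-u) - 1 + 1) =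
        psi (Real.exp u) := by
      rw [Real.exp_neg]
      field_simp
      ring
    simp only [e]
    exact psi_mono.comp Real.exp_monotone

lemma tendsto_theta_div : Tendsto (fun x => theta x / x) atTop (𝓝 1) := by
  have h : Tendsto (fun x => (psi x - theta x) / x) atTop (𝓝 0) := by
    refine (isBigO_psi_sub_theta_sqrt.trans_isLittleO ?_).tendsto_div_nhds_zero
    refine (Asymptotics.isLittleO_iff_tendsto' ?_).2 ?_
    · filter_upwards [eventually_gt_atTop 0] with x hx h0
      exact absurd h0 hx.ne'
    · simp only [Real.sqrt_div_self]
      exact Real.tendsto_sqrt_atTop.inv_tendsto_atTop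
  have := tendsto_psi_div.sub h
  rw [sub_zero] at this
  refine this.congr fun x => ?_
  ring

/-- The prime number theorem. -/
lemma tendsto_primeCounting_mul_log_div :
    Tendsto (fun x : ℝ => (Nat.primeCounting ⌊x⌋₊ : ℝ) * Real.log x / x) atTop (𝓝 1) := by
  have h : Tendsto (fun x : ℝ => (Nat.primeCounting ⌊x⌋₊ - theta x / Real.log x) /
      (x / Real.log x)) atTop (𝓝 0) := by
    refine (integral_theta_div_log_sq_isLittleO.congr' ?_ .rfl).tendsto_div_nhds_zero
    filter_upwards [eventually_ge_atTop 2] with x hx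
    rw [primeCounting_eq_theta_div_log_add_integral hx]
    ring
  have := h.add tendsto_theta_div
  rw [zero_add] at this
  refine this.congr' ?_
  filter_upwards [eventually_gt_atTop 1] with x hx
  have := Real.log_pos hx
  field_simp
  ring

end PrimeNumberTheorem

/-- The number of primes in the interval `(x / 2, x]`. -/
def primesInUpperHalf (x : ℕ) : ℕ := x.primeCounting - (x / 2).primeCounting

lemma primesInUpperHalf_succ_le (x : ℕ) : primesInUpperHalf (x + 1) ≤ primesInUpperHalf x + 1 := by
  have h1 : (x + 1).primeCounting ≤ x.primeCounting + 1 := by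
    simp only [Nat.primeCounting, Nat.primeCounting', Nat.count_succ _ (x + 1)]
    split_ifs <;> simp
  have h2 : (x / 2).primeCounting ≤ ((x + 1) / 2).primeCounting :=
    Nat.monotone_primeCounting (by omega)
  unfold primesInUpperHalf
  omega

lemma tendsto_log_natCast : Tendsto (fun x : ℕ => Real.log x) atTop atTop :=
  Real.tendsto_log_atTop.comp tendsto_natCast_atTop_atTop

lemma tendsto_primesInUpperHalf_mul_log_div :
    Tendsto (fun x : ℕ => (primesInUpperHalf x : ℝ) * (2 * Real.log x) / x) atTop (𝓝 1) := by
  have ha := tendsto_primeCounting_mul_log_div.comp (tendsto_natCast_atTop_atTop (R := ℝ))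
  have hb := tendsto_primeCounting_mul_log_div.comp
    ((tendsto_natCast_atTop_atTop (R := ℝ)).atTop_div_const two_pos)
  have hl : Tendsto (fun x : ℕ => (1 - Real.log 2 / Real.log x)⁻¹) atTop (𝓝 1) := by
    have h := (tendsto_log_natCast.const_div_atTop (Real.log 2)).const_sub 1
    rw [sub_zero] at h
    simpa using h.inv₀ one_ne_zero
  have h := (ha.const_mul 2).sub (hb.mul hl)
  norm_num at h
  refine h.congr' ?_
  filter_upwards [eventually_gt_atTop 2] with x hx
  have hx' : (2 : ℝ) < x := by exact_mod_cast hx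
  have hlog : 0 < Real.log x := Real.log_pos (by linarith)
  have hlog2 : Real.log 2 < Real.log x := Real.log_lt_log two_pos hx'
  have hle : (x / 2).primeCounting ≤ x.primeCounting := Nat.monotone_primeCounting (by omega)
  have hne : Real.log x - Real.log 2 ≠ 0 := by linarith
  simp only [Nat.floor_natCast, Nat.floor_div_ofNat, primesInUpperHalf,
    Nat.cast_sub hle]
  rw [Real.log_div (by positivity) two_ne_zero, one_sub_div hlog.ne', inv_div]
  field_simp

lemma tendsto_log_primesInUpperHalf_div_log :
    Tendsto (fun x : ℕ => Real.log (primesInUpperHalf x) / Real.log x) atTop (𝓝 1) := by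
  have hq := tendsto_primesInUpperHalf_mul_log_div
  have h1 : Tendsto (fun x : ℕ => Real.log ((primesInUpperHalf x : ℝ) * (2 * Real.log x) / x) /
      Real.log x) atTop (𝓝 0) :=
    (hq.log one_ne_zero).div_atTop tendsto_log_natCast
  have h2 : Tendsto (fun x : ℕ => Real.log 2 / Real.log x) atTop (𝓝 0) :=
    tendsto_log_natCast.const_div_atTop _
  have h3 : Tendsto (fun x : ℕ => Real.log (Real.log x) / Real.log x) atTop (𝓝 0) :=
    Real.isLittleO_log_id_atTop.tendsto_div_nhds_zero.comp tendsto_log_natCast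
  have h := ((h1.sub h2).sub h3).add_const 1
  norm_num at h
  refine h.congr' ?_
  filter_upwards [hq.eventually_const_lt one_half_lt_one, eventually_gt_atTop 1] with x hx hx1
  have hx1' : (1 : ℝ) < x := by exact_mod_cast hx1
  have hlog : 0 < Real.log x := Real.log_pos hx1'
  have hD : (primesInUpperHalf x : ℝ) ≠ 0 := by
    intro h0
    rw [h0] at hx
    norm_num at hx
  rw [Real.log_div (by positivity) (by positivity), Real.log_mul hD (by positivity),
    Real.log_mul two_ne_zero hlog.ne']
  field_simp
  ring

lemma tendsto_primesInUpperHalf : Tendsto primesInUpperHalf atTop atTop := by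
  rw [← tendsto_natCast_atTop_iff (R := ℝ)]
  have h := tendsto_log_primesInUpperHalf_div_log.pos_mul_atTop one_pos tendsto_log_natCast
  refine tendsto_atTop_mono' _ ?_ h
  filter_upwards [eventually_gt_atTop 1] with x hx
  have hlog : 0 < Real.log x := Real.log_pos (by exact_mod_cast hx)
  rw [div_mul_cancel₀ _ hlog.ne']
  exact Real.log_le_self (Nat.cast_nonneg _)

lemma ramanujan_mem (n : ℕ) :
    ramanujan n ∈ {R : ℕ | 0 < R ∧ ∀ x : ℕ, R ≤ x → n ≤ primesInUpperHalf x} := by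
  refine Nat.sInf_mem ?_
  obtain ⟨R, hR⟩ := eventually_atTop.1 (tendsto_primesInUpperHalf.eventually_ge_atTop n)
  exact ⟨R + 1, R.succ_pos, fun x hx => hR x (by omega)⟩

lemma primesInUpperHalf_ramanujan {n : ℕ} (hn : 0 < n) : primesInUpperHalf (ramanujan n) = n := by
  obtain ⟨hpos, hge⟩ := ramanujan_mem n
  refine le_antisymm ?_ (hge _ le_rfl)
  obtain ⟨k, hk⟩ := Nat.exists_eq_add_one.2 hpos
  have hk1 : 0 < k := by
    by_contra! h0
    obtain rfl : k = 0 := by omega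
    have h1 := hge _ le_rfl
    rw [hk] at h1
    have h2 : primesInUpperHalf (0 + 1) = 0 := by simp [primesInUpperHalf]
    omega
  have hnot : k ∉ {R : ℕ | 0 < R ∧ ∀ x : ℕ, R ≤ x → n ≤ primesInUpperHalf x} :=
    Nat.notMem_of_lt_sInf (show k < ramanujan n by omega)
  have hlt : primesInUpperHalf k < n := by
    by_contra! hcon
    refine hnot ⟨hk1, fun x hx => ?_⟩
    rcases hx.eq_or_lt with rfl | hx
    · exact hcon
    · exact hge x (by omega)
  rw [hk]
  have := primesInUpperHalf_succ_le k
  omega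

lemma tendsto_ramanujan : Tendsto ramanujan atTop atTop := by
  refine tendsto_atTop_mono (fun n => ?_) tendsto_id
  have h := (ramanujan_mem n).2 _ le_rfl
  have h1 : primesInUpperHalf (ramanujan n) ≤ ramanujan n := by
    refine (Nat.sub_le _ _).trans ?_
    simp only [Nat.primeCounting, Nat.primeCounting', Nat.count_succ', Nat.not_prime_zero, if_false,
      add_zero]
    exact Nat.count_le _
  exact h.trans h1

lemma tendsto_div_primesInUpperHalf_mul_log :
    Tendsto (fun x : ℕ => (x : ℝ) / (2 * primesInUpperHalf x * Real.log (primesInUpperHalf x)))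
      atTop (𝓝 1) := by
  have h := (tendsto_primesInUpperHalf_mul_log_div.mul
    tendsto_log_primesInUpperHalf_div_log).inv₀ (by norm_num)
  norm_num at h
  refine h.congr' ?_
  filter_upwards [eventually_gt_atTop 1] with x hx
  have hlog : Real.log x ≠ 0 := (Real.log_pos (by exact_mod_cast hx)).ne'
  field_simp

theorem ramanujan_asymptotic :
    Filter.Tendsto (fun n : ℕ => (ramanujan n : ℝ) / (2 * n * Real.log n))
      Filter.atTop (nhds 1) := by
  refine (tendsto_div_primesInUpperHalf_mul_log.comp tendsto_ramanujan).congr' ?_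
  filter_upwards [eventually_gt_atTop 0] with n hn
  simp only [Function.comp_apply, primesInUpperHalf_ramanujan hn]
end

section
/- For every positive integer n, π(p_{3n}) − π(p_{3n}/2) > n, where p_k denotes the k-th prime number. Equivalently, π(p_{3n}/2) < 2n for all n ≥ 1. -/
/-- `piR x` is the prime-counting function at a real argument: the number of primes `≤ ⌊x⌋`. -/
noncomputable def piR (x : ℝ) : ℕ := Nat.primeCounting ⌊x⌋₊
/-- `nthPrime k` is the `k`-th prime, 1-indexed: `nthPrime 1 = 2`, `nthPrime 2 = 3`, ... -/
noncomputable def nthPrime (k : ℕ) : ℕ := Nat.nth Nat.Prime (k - 1)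

open scoped Nat.Prime Chebyshev ArithmeticFunction.vonMangoldt

/-- The number of `n ∈ [6 * a, 6 * (a + len))` coprime to `P`, where `6 ∣ P`, computed by bisection
of depth `k`; correct when `len ≤ 2 ^ k`. -/
def coprimeCount (P : ℕ) : ℕ → ℕ → ℕ → ℕ
  | 0, a, len => len / Nat.gcd (6 * a + 1) P + len / Nat.gcd (6 * a + 5) P
  | k + 1, a, len => coprimeCount P k a (len / 2) + coprimeCount P k (a + len / 2) (len - len / 2)

theorem one_div_gcd_eq_ite {P : ℕ} (hP : P ≠ 0) (n : ℕ) :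
    1 / Nat.gcd n P = if n.Coprime P then 1 else 0 := by
  have hg : 0 < Nat.gcd n P := Nat.gcd_pos_of_pos_right _ (Nat.pos_of_ne_zero hP)
  split_ifs with h
  · rw [h.gcd_eq_one]
  · exact Nat.div_eq_of_lt (by rw [Nat.Coprime] at h; omega)

theorem coprimeCount_eq_count {P : ℕ} (hP : P ≠ 0) (h6 : 6 ∣ P) {k a len : ℕ}
    (hlen : len ≤ 2 ^ k) :
    coprimeCount P k a len = Nat.count (fun i ↦ Nat.Coprime (6 * a + i) P) (6 * len) := by
  induction k generalizing a len with
  | zero =>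
    obtain rfl | rfl : len = 0 ∨ len = 1 := by
      rw [pow_zero] at hlen
      omega
    · simp [coprimeCount]
    · have h2 (n : ℕ) (hn : 2 ∣ n) : ¬ n.Coprime P :=
        Nat.not_coprime_of_dvd_of_dvd one_lt_two hn ((by norm_num : 2 ∣ 6).trans h6)
      have h3 (n : ℕ) (hn : 3 ∣ n) : ¬ n.Coprime P :=
        Nat.not_coprime_of_dvd_of_dvd (by norm_num) hn ((by norm_num : 3 ∣ 6).trans h6)
      simp only [coprimeCount, one_div_gcd_eq_ite hP, mul_one, Nat.count_succ, Nat.count_zero,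
        if_neg (h2 (6 * a) (by omega)), if_neg (h2 (6 * a + 2) (by omega)),
        if_neg (h3 (6 * a + 3) (by omega)), if_neg (h2 (6 * a + 4) (by omega)), zero_add, add_zero]
  | succ k ih =>
    rw [pow_succ] at hlen
    rw [coprimeCount, ih (by omega), ih (by omega)]
    conv_rhs => rw [show 6 * len = 6 * (len / 2) + 6 * (len - len / 2) by omega, Nat.count_add]
    simp only [mul_add, add_assoc]

theorem prime_iff_coprime_of_dvd_iff {r P n : ℕ} (hP : ∀ p : ℕ, p.Prime → (p ∣ P ↔ p ≤ r))
    (hr : r < n) (hn : n < (r + 1) ^ 2) (hn1 : n ≠ 1) : n.Prime ↔ n.Coprime P := by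
  constructor
  · intro h
    refine (Nat.Prime.coprime_iff_not_dvd h).2 fun hd ↦ ?_
    have := (hP n h).1 hd
    omega
  · intro h
    by_contra hp
    have hsq := Nat.minFac_sq_le_self (by omega) hp
    have hlt : n.minFac < r + 1 := lt_of_pow_lt_pow_left₀ 2 (by omega) (hsq.trans_lt hn)
    have hpr := Nat.minFac_prime hn1
    exact hpr.one_lt.ne'
      (Nat.eq_one_of_dvd_coprimes h n.minFac_dvd ((hP _ hpr).2 (Nat.lt_succ_iff.1 hlt)))

theorem primeCounting'_add {r P a len k : ℕ} (hP0 : P ≠ 0) (h6 : 6 ∣ P)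
    (hP : ∀ p : ℕ, p.Prime → (p ∣ P ↔ p ≤ r)) (hr0 : 0 < r) (hr : r < 6 * a)
    (ha : 6 * (a + len) ≤ (r + 1) ^ 2) (hlen : len ≤ 2 ^ k) :
    π' (6 * (a + len)) = π' (6 * a) + coprimeCount P k a len := by
  rw [coprimeCount_eq_count hP0 h6 hlen, Nat.primeCounting', mul_add, Nat.count_add]
  congr 1
  rw [Nat.count_eq_card_filter_range, Nat.count_eq_card_filter_range]
  congr 1
  refine Finset.filter_congr fun i hi ↦ prime_iff_coprime_of_dvd_iff hP ?_ ?_ ?_ <;>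
    rw [Finset.mem_range] at hi <;> omega

/-- From `s = (u, π' (6 * u), π' (12 * u))`, advance `u` by `u / 6` for `n` times, as long as the
test guaranteeing `3 * π (p / 2) < 2 * π p` for all primes `p` passed over succeeds. -/
def advance (r P : ℕ) : ℕ → ℕ × ℕ × ℕ → Option (ℕ × ℕ × ℕ)
  | 0, s => some s
  | n + 1, (u, a, b) =>
    if r < 6 * u ∧ 6 * (2 * (u + u / 6)) ≤ (r + 1) ^ 2 ∧
        3 * (a + coprimeCount P ((u / 6).log2 + 1) u (u / 6)) < 2 * b + 2 then
      advance r P n (u + u / 6, a + coprimeCount P ((u / 6).log2 + 1) u (u / 6),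
        b + coprimeCount P ((u / 6).log2 + 2) (2 * u) (2 * (u / 6)))
    else none

/-- `s = (u, π' (6 * u), π' (12 * u))`, and `3 * π (p / 2) < 2 * π p` for all primes
`p < 12 * u`. -/
def IsValidUpTo (s : ℕ × ℕ × ℕ) : Prop :=
  s.2.1 = π' (6 * s.1) ∧ s.2.2 = π' (6 * (2 * s.1)) ∧
    ∀ p < 12 * s.1, p.Prime → 3 * π (p / 2) < 2 * π p

theorem IsValidUpTo.advance {r P : ℕ} (hP0 : P ≠ 0) (h6 : 6 ∣ P)
    (hP : ∀ p : ℕ, p.Prime → (p ∣ P ↔ p ≤ r)) (hr0 : 0 < r) {n : ℕ} {s t : ℕ × ℕ × ℕ}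
    (hs : IsValidUpTo s) (hst : advance r P n s = some t) : IsValidUpTo t := by
  induction n generalizing s with
  | zero =>
    rw [_root_.advance, Option.some_inj] at hst
    exact hst ▸ hs
  | succ n ih =>
    obtain ⟨u, a, b⟩ := s
    rw [_root_.advance] at hst
    split at hst
    case isFalse => simp at hst
    case isTrue h =>
    obtain ⟨hru, hur, hab⟩ := h
    obtain ⟨ha, hb, hp⟩ := hs
    dsimp only at ha hb hp
    subst ha hb
    have hlog : u / 6 < 2 ^ ((u / 6).log2 + 1) := Nat.lt_log2_self
    have hlog' : 2 * (u / 6) ≤ 2 ^ ((u / 6).log2 + 2) := by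
      rw [pow_succ]
      omega
    rw [← primeCounting'_add hP0 h6 hP hr0 hru (by omega) hlog.le] at hst hab
    rw [← primeCounting'_add hP0 h6 hP hr0 (by omega) (by omega) hlog', ← mul_add] at hst
    refine ih ⟨rfl, rfl, fun p hpu hpp ↦ ?_⟩ hst
    dsimp only at hpu
    obtain hlt | hge := lt_or_ge p (12 * u)
    · exact hp p hlt hpp
    have h₁ : π (p / 2) ≤ π' (6 * (u + u / 6)) := Nat.monotone_primeCounting' (by omega)
    have h₂ : π' (6 * (2 * u)) ≤ π' p := Nat.monotone_primeCounting' (by omega)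
    have h₃ : π p = π' p + 1 := by
      rw [Nat.primeCounting, Nat.primeCounting', Nat.count_succ, if_pos hpp]
    omega

theorem dvd_iff_le_of_dvd_factorial {r P k : ℕ} (h₁ : P ∣ r.factorial) (h₂ : r.factorial ∣ P ^ k)
    (p : ℕ) (hp : p.Prime) : p ∣ P ↔ p ≤ r :=
  ⟨fun h ↦ hp.dvd_factorial.1 (h.trans h₁),
    fun h ↦ hp.dvd_of_dvd_pow ((hp.dvd_factorial.2 h).trans h₂)⟩

theorem three_mul_primeCounting_half_lt_of_lt {p : ℕ} (hp : p.Prime) (hlt : p < 131072) :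
    3 * π (p / 2) < 2 * π p := by
  have h₀ : IsValidUpTo (6, 11, 20) := by
    refine ⟨?_, ?_, ?_⟩ <;> decide +kernel
  have h₁ : IsValidUpTo (78, 91, 158) :=
    h₀.advance (r := 31) (P := 200560490130) (n := 19) (by norm_num) (by norm_num)
      (dvd_iff_le_of_dvd_factorial (k := 31) (by decide +kernel) (by decide +kernel))
      (by norm_num) (by decide +kernel)
  have h₂ : IsValidUpTo (12229, 7247, 13569) :=
    h₁.advance (r := 396) (n := 33)
      (P := 256201040651931599305382461251925781858847170265198996852091190629324168449027728035542876334984578188245059186229973899465052910204193443350680384306794366570)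
      (by norm_num) (by norm_num)
      (dvd_iff_le_of_dvd_factorial (k := 396) (by decide +kernel) (by decide +kernel))
      (by norm_num) (by decide +kernel)
  exact h₂.2.2 p (by dsimp only; omega) hp

theorem log_factorial_eq_sum_vonMangoldt {n N : ℕ} (h : n ≤ N) :
    Real.log n.factorial = ∑ d ∈ Finset.Ioc 0 N, Λ d * (n / d : ℕ) := by
  induction n with
  | zero => simp
  | succ n ih =>
    have hdiv : (Finset.Ioc 0 N).filter (· ∣ n + 1) = (n + 1).divisors := by
      ext d
      simp only [Finset.mem_filter, Finset.mem_Ioc, Nat.mem_divisors]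
      refine ⟨fun hd ↦ ⟨hd.2, n.succ_ne_zero⟩, fun hd ↦ ⟨⟨?_, ?_⟩, hd.1⟩⟩
      · exact Nat.pos_of_dvd_of_pos hd.1 n.succ_pos
      · exact (Nat.le_of_dvd n.succ_pos hd.1).trans h
    rw [Nat.factorial_succ, Nat.cast_mul, Real.log_mul (by positivity) (by positivity),
      ih (by omega), ← ArithmeticFunction.vonMangoldt_sum, ← hdiv, Finset.sum_filter,
      ← Finset.sum_add_distrib]
    refine Finset.sum_congr rfl fun d _ ↦ ?_
    rw [Nat.succ_div]
    split_ifs <;> push_cast <;> ring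

theorem mul_log_sub_self_add_le {a b : ℝ} (ha : 0 < a) (hb : 0 < b) :
    a * Real.log a - a + (b - a) * Real.log a ≤ b * Real.log b - b := by
  have h := Real.one_sub_inv_le_log_of_pos (div_pos hb ha)
  rw [Real.log_div hb.ne' ha.ne', inv_div] at h
  have := mul_le_mul_of_nonneg_left h hb.le
  rw [mul_sub, mul_one, mul_div_cancel₀ _ hb.ne'] at this
  linarith

theorem log_factorial_le_of_le {m : ℕ} {x : ℝ} (hm : m ≠ 0) (hmx : m ≤ x) :
    Real.log m.factorial ≤ x * Real.log x - x + Real.log x / 2 + 1 := by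
  have hm1 : (1 : ℝ) ≤ m := mod_cast Nat.one_le_iff_ne_zero.2 hm
  have hlog : Real.log m ≤ Real.log x := Real.log_le_log (by positivity) hmx
  have h₁ := mul_log_sub_self_add_le (a := m) (b := x) (by positivity) (by linarith)
  have h₂ : 0 ≤ (x - m) * Real.log m := mul_nonneg (by linarith) (Real.log_nonneg hm1)
  have h₃ := Stirling.log_stirlingSeq'_antitone (Nat.zero_le (m - 1))
  simp only [Function.comp, Nat.succ_eq_add_one, Nat.sub_add_cancel (Nat.one_le_iff_ne_zero.2 hm),
    Stirling.log_stirlingSeq_formula] at h₃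
  rw [Real.log_mul two_ne_zero (by positivity), Real.log_div (by positivity) (by positivity),
    Real.log_exp] at h₃
  norm_num at h₃
  linarith

theorem le_log_factorial_of_lt {m : ℕ} {x : ℝ} (hx : 1 ≤ x) (hmx : m ≤ x) (hxm : x < m + 1) :
    x * Real.log x - x - Real.log x / 2 ≤ Real.log m.factorial := by
  have h₁ := Stirling.le_log_factorial_stirling (n := m + 1) (by omega)
  rw [Nat.factorial_succ, Nat.cast_mul, Real.log_mul (x := ((m + 1 : ℕ) : ℝ))
    (y := (m.factorial : ℝ)) (by positivity) (by positivity)] at h₁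
  push_cast at h₁
  set M : ℝ := m + 1
  have h₂ := mul_log_sub_self_add_le (a := x) (b := M) (by positivity) (by positivity)
  have hlog := Real.log_nonneg hx
  have h₃ : Real.log M ≤ Real.log x + (M - x) := by
    have h := Real.log_le_sub_one_of_pos (x := M / x) (by positivity)
    rw [Real.log_div (by positivity) (by positivity)] at h
    have : M / x - 1 ≤ M - x := by
      rw [div_sub_one (by positivity), div_le_iff₀ (by positivity)]
      nlinarith
    linarith
  have h₄ : 1 ≤ Real.log (2 * Real.pi) := by
    rw [Real.le_log_iff_exp_le (by positivity)]
    linarith [Real.exp_one_lt_d9, Real.pi_gt_three]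
  have h₅ : 0 ≤ (M - x) * Real.log x := mul_nonneg (by linarith) hlog
  have h₆ : M ≤ x + 1 := by simpa [M] using hmx
  linarith

/-- Chebyshev's combination `log (n! ⌊n/30⌋! / (⌊n/2⌋! ⌊n/3⌋! ⌊n/5⌋!))`. -/
noncomputable def chebyshevLog (n : ℕ) : ℝ :=
  Real.log n.factorial + Real.log (n / 30).factorial - Real.log (n / 2).factorial -
    Real.log (n / 3).factorial - Real.log (n / 5).factorial

theorem chebyshevLog_eq_sum (n : ℕ) :
    chebyshevLog n = ∑ d ∈ Finset.Ioc 0 n,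
      Λ d * (((n / d + n / d / 30 : ℕ) : ℝ) - (n / d / 2 + n / d / 3 + n / d / 5 : ℕ)) := by
  have h (k : ℕ) : Real.log (n / k).factorial =
      ∑ d ∈ Finset.Ioc 0 n, Λ d * (n / d / k : ℕ) := by
    rw [log_factorial_eq_sum_vonMangoldt (Nat.div_le_self n k)]
    simp only [Nat.div_div_eq_div_mul, mul_comm]
  rw [chebyshevLog, log_factorial_eq_sum_vonMangoldt le_rfl, h, h, h, h,
    ← Finset.sum_add_distrib, ← Finset.sum_sub_distrib, ← Finset.sum_sub_distrib,
    ← Finset.sum_sub_distrib]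
  refine Finset.sum_congr rfl fun d _ ↦ ?_
  push_cast
  ring

theorem chebyshevLog_le_psi (n : ℕ) : chebyshevLog n ≤ ψ n := by
  rw [chebyshevLog_eq_sum, Chebyshev.psi, Nat.floor_natCast]
  refine Finset.sum_le_sum fun d _ ↦ ?_
  refine mul_le_of_le_one_right ArithmeticFunction.vonMangoldt_nonneg ?_
  rw [sub_le_iff_le_add']
  norm_cast
  omega

theorem psi_sub_psi_div_six_le (n : ℕ) : ψ n - ψ (n / 6 : ℕ) ≤ chebyshevLog n := by
  rw [chebyshevLog_eq_sum, Chebyshev.psi, Chebyshev.psi, Nat.floor_natCast, Nat.floor_natCast,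
    sub_le_iff_le_add', ← Finset.sum_Ioc_consecutive _ (Nat.zero_le _) (Nat.div_le_self n 6),
    ← Finset.sum_Ioc_consecutive _ (Nat.zero_le _) (Nat.div_le_self n 6), ← add_assoc]
  refine add_le_add (le_add_of_nonneg_right (Finset.sum_nonneg fun d _ ↦ ?_))
    (Finset.sum_le_sum fun d hd ↦ ?_)
  · refine mul_nonneg ArithmeticFunction.vonMangoldt_nonneg ?_
    rw [sub_nonneg]
    norm_cast
    omega
  · rw [Finset.mem_Ioc] at hd
    refine le_mul_of_one_le_right ArithmeticFunction.vonMangoldt_nonneg ?_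
    have h₁ : n / d < 6 := (Nat.div_lt_iff_lt_mul (by omega)).2 (by omega)
    have h₂ : 0 < n / d := Nat.div_pos hd.2 (by omega)
    rw [le_sub_iff_add_le]
    norm_cast
    omega

theorem log_five_bounds : 1.60936 < Real.log 5 ∧ Real.log 5 < 1.60952 := by
  have h : Real.log (81 / 80) = 4 * Real.log 3 - 4 * Real.log 2 - Real.log 5 := by
    rw [Real.log_div (by norm_num) (by norm_num), show (81 : ℝ) = 3 ^ 4 by norm_num,
      show (80 : ℝ) = 2 ^ 4 * 5 by norm_num, Real.log_mul (by norm_num) (by norm_num),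
      Real.log_pow, Real.log_pow]
    push_cast
    ring
  have h₁ := Real.log_le_sub_one_of_pos (x := 81 / 80) (by norm_num)
  have h₂ := Real.one_sub_inv_le_log_of_pos (x := 81 / 80) (by norm_num)
  rw [h] at h₁ h₂
  norm_num at h₁ h₂
  constructor <;> linarith [Real.log_two_gt_d9, Real.log_two_lt_d9, Real.log_three_gt_d9,
    Real.log_three_lt_d9]

theorem log_thirty : Real.log 30 = Real.log 2 + Real.log 3 + Real.log 5 := by
  rw [← Real.log_mul (by norm_num) (by norm_num), ← Real.log_mul (by norm_num) (by norm_num)]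
  norm_num

theorem chebyshevLog_bounds {n : ℕ} (hn : 30 ≤ n) :
    0.9212 * n - 5 / 2 * Real.log n ≤ chebyshevLog n ∧
      chebyshevLog n ≤ 0.9214 * n + 5 / 2 * Real.log n := by
  have hn' : (30 : ℝ) ≤ n := mod_cast hn
  have hle (k : ℕ) : ((n / k : ℕ) : ℝ) ≤ n / k := Nat.cast_div_le
  have hlt (k : ℕ) (hk : 0 < k) : (n / k : ℝ) < (n / k : ℕ) + 1 := by
    rw [div_lt_iff₀ (by positivity)]
    exact_mod_cast Nat.lt_mul_of_div_lt (Nat.lt_succ_self _) hk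
  have hlog (k : ℝ) (hk : 0 < k) : Real.log (n / k) = Real.log n - Real.log k :=
    Real.log_div (by positivity) hk.ne'
  have u₁ := log_factorial_le_of_le (m := n) (by omega) le_rfl
  have u₂ := log_factorial_le_of_le (by omega) (hle 2)
  have u₃ := log_factorial_le_of_le (by omega) (hle 3)
  have u₅ := log_factorial_le_of_le (by omega) (hle 5)
  have u₆ := log_factorial_le_of_le (by omega) (hle 30)
  have l₁ := le_log_factorial_of_lt (m := n) (by linarith) le_rfl (by linarith)
  have l₂ := le_log_factorial_of_lt (by push_cast; linarith) (hle 2) (hlt 2 (by norm_num))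
  have l₃ := le_log_factorial_of_lt (by push_cast; linarith) (hle 3) (hlt 3 (by norm_num))
  have l₅ := le_log_factorial_of_lt (by push_cast; linarith) (hle 5) (hlt 5 (by norm_num))
  have l₆ := le_log_factorial_of_lt (by push_cast; linarith) (hle 30) (hlt 30 (by norm_num))
  push_cast at u₂ u₃ u₅ u₆ l₂ l₃ l₅ l₆
  rw [hlog _ (by norm_num)] at u₂ u₃ u₅ u₆ l₂ l₃ l₅ l₆
  rw [log_thirty] at u₆ l₆
  obtain ⟨a₅, b₅⟩ := log_five_bounds
  have a₂ := Real.log_two_gt_d9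
  have b₂ := Real.log_two_lt_d9
  have a₃ := Real.log_three_gt_d9
  have b₃ := Real.log_three_lt_d9
  have hA : 0.9212 * n ≤ n * (Real.log 2 / 2 + Real.log 3 / 3 + Real.log 5 / 5 -
      (Real.log 2 + Real.log 3 + Real.log 5) / 30) := by
    rw [mul_comm]
    gcongr
    linarith
  have hB : n * (Real.log 2 / 2 + Real.log 3 / 3 + Real.log 5 / 5 -
      (Real.log 2 + Real.log 3 + Real.log 5) / 30) ≤ 0.9214 * n := by
    rw [mul_comm]
    gcongr
    linarith
  rw [chebyshevLog]
  constructor <;> linarith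

theorem psi_le_add_log_sq {n : ℕ} (hn : 1 ≤ n) : ψ n ≤ 1.1057 * n + Real.log n ^ 2 := by
  induction n using Nat.strong_induction_on with
  | _ n ih =>
  obtain hlt | hge := lt_or_ge n 30
  · have h : Nat.lcmUpto n ≤ 3 ^ n := by
      clear ih hn
      interval_cases n <;> decide +kernel
    have h' : ψ n ≤ n * Real.log 3 := by
      rw [Chebyshev.psi_eq_log_lcmUpto, ← Real.log_pow]
      exact Real.log_le_log (mod_cast Nat.lcmUpto_pos n) (mod_cast h)
    have : n * Real.log 3 ≤ n * 1.1057 := by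
      gcongr
      linarith [Real.log_three_lt_d9]
    linarith [sq_nonneg (Real.log n)]
  · have hn' : (30 : ℝ) ≤ n := mod_cast hge
    have h₁ := ih (n / 6) (by omega) (by omega)
    have h₂ := (psi_sub_psi_div_six_le n).trans (chebyshevLog_bounds hge).2
    have h₃ : ((n / 6 : ℕ) : ℝ) ≤ n / 6 := Nat.cast_div_le
    have h₄ : Real.log (n / 6 : ℕ) ≤ Real.log n - (Real.log 2 + Real.log 3) := by
      have h6 : Real.log 2 + Real.log 3 = Real.log 6 := by
        rw [← Real.log_mul (by norm_num) (by norm_num)]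
        norm_num
      rw [h6, ← Real.log_div (by positivity) (by norm_num)]
      exact Real.log_le_log (mod_cast (by omega)) h₃
    have h₅ : Real.log (n / 6 : ℕ) ^ 2 ≤ (Real.log n - (Real.log 2 + Real.log 3)) ^ 2 :=
      pow_le_pow_left₀ (Real.log_natCast_nonneg _) h₄ 2
    have h₆ : 3.39 ≤ Real.log n := by
      have := Real.log_le_log (by norm_num) hn'
      rw [log_thirty] at this
      linarith [log_five_bounds.1, Real.log_two_gt_d9, Real.log_three_gt_d9]
    have a₂ := Real.log_two_gt_d9
    have a₃ := Real.log_three_gt_d9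
    have b₂ := Real.log_two_lt_d9
    have b₃ := Real.log_three_lt_d9
    nlinarith

theorem psi_le_add_log_sq' {x : ℝ} (hx : 1 ≤ x) : ψ x ≤ 1.1057 * x + Real.log x ^ 2 := by
  have h1 : 1 ≤ ⌊x⌋₊ := Nat.le_floor (mod_cast hx)
  rw [Chebyshev.psi_eq_psi_coe_floor]
  have hfl := Nat.floor_le (zero_le_one.trans hx)
  refine (psi_le_add_log_sq h1).trans (add_le_add (by linarith) ?_)
  exact pow_le_pow_left₀ (Real.log_natCast_nonneg _)
    (Real.log_le_log (mod_cast h1) hfl) 2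

theorem integral_one_div_log_sq_le_sub_div {a b : ℝ} (ha : 1 < a) (hab : a ≤ b) :
    ∫ t in a..b, 1 / Real.log t ^ 2 ≤ (b - a) / Real.log a ^ 2 := by
  have h := intervalIntegral.integral_mono_on hab
    (Chebyshev.intervalIntegrable_one_div_log_sq ha (ha.trans_le hab))
    (intervalIntegrable_const (c := 1 / Real.log a ^ 2)) fun t ht ↦ by
      have := Real.log_pos ha
      have := Real.log_le_log (by linarith) ht.1
      gcongr
  rwa [intervalIntegral.integral_const, smul_eq_mul, mul_one_div] at h

theorem integral_one_div_log_sq_le_of_exp_eight_le {a b : ℝ} (ha : 1 < a) (ha8 : 8 ≤ Real.log a)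
    (hab : a ≤ b) :
    ∫ t in a..b, 1 / Real.log t ^ 2 ≤ 4 / 3 * (b / Real.log b ^ 2) := by
  have hlog (t : ℝ) (ht : a ≤ t) : 8 ≤ Real.log t :=
    ha8.trans (Real.log_le_log (by linarith) ht)
  have hd (t : ℝ) (ht : a ≤ t) : HasDerivAt (fun t ↦ 4 / 3 * (t / Real.log t ^ 2))
      (4 / 3 * (1 / Real.log t ^ 2 - 2 / Real.log t ^ 3)) t := by
    have h0 : t ≠ 0 := by linarith
    have hl : Real.log t ≠ 0 := by linarith [hlog t ht]
    refine (((hasDerivAt_id' t).fun_div ((Real.hasDerivAt_log h0).fun_pow 2)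
      (pow_ne_zero 2 hl)).const_mul (4 / 3 : ℝ)).congr_deriv ?_
    field_simp
    norm_num
    ring
  have h := intervalIntegral.integral_le_sub_of_hasDeriv_right_of_le hab
    (fun t ht ↦ (hd t ht.1).continuousAt.continuousWithinAt)
    (fun t ht ↦ (hd t ht.1.le).hasDerivWithinAt)
    ((intervalIntegrable_iff_integrableOn_Icc_of_le hab).1
      (Chebyshev.intervalIntegrable_one_div_log_sq ha (ha.trans_le hab)))
    fun t ht ↦ by
      have hl := hlog t ht.1.le
      rw [show (4 / 3 : ℝ) * (1 / Real.log t ^ 2 - 2 / Real.log t ^ 3) =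
        1 / Real.log t ^ 2 + (Real.log t - 8) / (3 * Real.log t ^ 3) by field_simp; ring]
      exact le_add_of_nonneg_right (div_nonneg (by linarith) (by positivity))
  have : 0 ≤ 4 / 3 * (a / Real.log a ^ 2) := by positivity
  linarith

theorem integral_one_div_log_sq_le {x : ℝ} (hx : 4096 ≤ x) :
    ∫ t in 2..x, 1 / Real.log t ^ 2 ≤ 4 / 3 * (x / Real.log x ^ 2) + 210 := by
  have hint {a b : ℝ} (ha : 1 < a) (hb : 1 < b) :=
    Chebyshev.intervalIntegrable_one_div_log_sq ha hb
  rw [← intervalIntegral.integral_add_adjacent_intervals (hint (b := 4096) (by norm_num)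
      (by norm_num)) (hint (by norm_num) (by linarith)),
    ← intervalIntegral.integral_add_adjacent_intervals (hint (b := 128) (by norm_num)
      (by norm_num)) (hint (by norm_num) (by norm_num)),
    ← intervalIntegral.integral_add_adjacent_intervals (hint (b := 8) (by norm_num)
      (by norm_num)) (hint (by norm_num) (by norm_num))]
  have h2 := Real.log_two_gt_d9
  have l8 : Real.log 8 = 3 * Real.log 2 := by
    rw [show (8 : ℝ) = 2 ^ 3 by norm_num, Real.log_pow]
    norm_num
  have l128 : Real.log 128 = 7 * Real.log 2 := by
    rw [show (128 : ℝ) = 2 ^ 7 by norm_num, Real.log_pow]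
    norm_num
  have l4096 : Real.log 4096 = 12 * Real.log 2 := by
    rw [show (4096 : ℝ) = 2 ^ 12 by norm_num, Real.log_pow]
    norm_num
  have h (c k : ℝ) (hc : 0 ≤ c) (hk : 0 < k) :
      c / (k * Real.log 2) ^ 2 ≤ c / k ^ 2 / 0.48 := by
    rw [mul_pow, ← div_div]
    gcongr
    nlinarith
  have i₁ := integral_one_div_log_sq_le_sub_div (a := 2) (b := 8) (by norm_num) (by norm_num)
  have i₂ := integral_one_div_log_sq_le_sub_div (a := 8) (b := 128) (by norm_num) (by norm_num)
  have i₃ := integral_one_div_log_sq_le_sub_div (a := 128) (b := 4096) (by norm_num) (by norm_num)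
  have i₄ := integral_one_div_log_sq_le_of_exp_eight_le (by norm_num) (by linarith) hx
  have j₁ := h (8 - 2) 1 (by norm_num) (by norm_num)
  have j₂ := h (128 - 8) 3 (by norm_num) (by norm_num)
  have j₃ := h (4096 - 128) 7 (by norm_num) (by norm_num)
  rw [one_mul] at j₁
  rw [l8] at i₂
  rw [l128] at i₃
  norm_num at i₁ i₂ i₃ j₁ j₂ j₃ ⊢
  norm_num at i₄
  linarith

theorem primeCounting_floor_mul_log_le {x : ℝ} (hx : 4096 ≤ x) :
    π ⌊x⌋₊ * Real.log x ≤ 1.1057 * x + 1.1057 * (4 / 3 * (x / Real.log x) + 210 * Real.log x) +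
      2 * Real.log x ^ 2 := by
  have hl : 0 < Real.log x := Real.log_pos (by linarith)
  have hint := Chebyshev.intervalIntegrable_one_div_log_sq (a := 2) (b := x) (by norm_num)
    (by linarith)
  have hinv : IntervalIntegrable (fun t : ℝ ↦ 1 / t) MeasureTheory.volume 2 x :=
    intervalIntegral.intervalIntegrable_one_div (fun t ht ↦ by
      rw [Set.uIcc_of_le (by linarith)] at ht
      linarith [ht.1]) continuousOn_id
  have h₁ : ∫ t in 2..x, θ t / (t * Real.log t ^ 2) ≤
      ∫ t in 2..x, (1.1057 * (1 / Real.log t ^ 2) + 1 / t) := by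
    refine intervalIntegral.integral_mono_on (by linarith)
      ((intervalIntegrable_iff_integrableOn_Icc_of_le (by linarith)).2
        (Chebyshev.integrableOn_theta_div_id_mul_log_sq x)) ((hint.const_mul _).add hinv)
      fun t ht ↦ ?_
    have ht0 : 0 < t := by linarith [ht.1]
    have hlt : 0 < Real.log t := Real.log_pos (by linarith [ht.1])
    rw [div_le_iff₀ (by positivity)]
    refine ((Chebyshev.theta_le_psi t).trans (psi_le_add_log_sq' (by linarith [ht.1]))).trans_eq ?_
    field_simp
  rw [intervalIntegral.integral_add (hint.const_mul _) hinv,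
    intervalIntegral.integral_const_mul, integral_one_div_of_pos (by norm_num) (by linarith)] at h₁
  have h₂ := integral_one_div_log_sq_le hx
  have h₃ : Real.log (x / 2) ≤ Real.log x := Real.log_le_log (by linarith) (by linarith)
  have h₄ := (Chebyshev.theta_le_psi x).trans (psi_le_add_log_sq' (by linarith))
  rw [Chebyshev.primeCounting_eq_theta_div_log_add_integral (by linarith), add_mul,
    div_mul_cancel₀ _ hl.ne']
  calc _ ≤ (1.1057 * x + Real.log x ^ 2) +
      (1.1057 * (4 / 3 * (x / Real.log x ^ 2) + 210) + Real.log x) * Real.log x := by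
        gcongr
        linarith
    _ = _ := by
      field_simp
      ring

theorem theta_sub_theta_half_le (p : ℕ) :
    θ p - θ (p / 2 : ℕ) ≤ ((π p : ℝ) - π (p / 2)) * Real.log p := by
  have hsub : (Finset.Ioc 0 (p / 2)).filter Nat.Prime ⊆ (Finset.Ioc 0 p).filter Nat.Prime :=
    Finset.filter_subset_filter _ (Finset.Ioc_subset_Ioc_right (Nat.div_le_self p 2))
  have hcard (n : ℕ) : π n = ((Finset.Ioc 0 n).filter Nat.Prime).card := by
    rw [Nat.primeCounting, Nat.primeCounting', Nat.count_eq_card_filter_range]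
    congr 1
    ext q
    simp only [Finset.mem_filter, Finset.mem_range, Finset.mem_Ioc]
    exact ⟨fun h ↦ ⟨⟨h.2.pos, by omega⟩, h.2⟩, fun h ↦ ⟨by omega, h.2⟩⟩
  rw [hcard, hcard, ← Nat.cast_sub (Finset.card_le_card hsub), ← Finset.card_sdiff_of_subset hsub,
    Chebyshev.theta, Chebyshev.theta, Nat.floor_natCast, Nat.floor_natCast,
    ← Finset.sum_sdiff hsub, add_sub_cancel_right, ← nsmul_eq_mul]
  refine Finset.sum_le_card_nsmul _ _ _ fun q hq ↦ ?_
  simp only [Finset.mem_sdiff, Finset.mem_filter, Finset.mem_Ioc] at hq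
  exact Real.log_le_log (mod_cast hq.1.1.1) (mod_cast hq.1.1.2)

theorem le_theta {n : ℕ} (hn : 30 ≤ n) :
    0.9212 * n - 5 / 2 * Real.log n - 3 * (1.1057 * √n + (Real.log n / 2) ^ 2) ≤ θ n := by
  have hn1 : (1 : ℝ) ≤ n := mod_cast (by omega)
  have h₁ := (chebyshevLog_bounds hn).1.trans (chebyshevLog_le_psi n)
  have h₂ := Chebyshev.psi_sub_theta_le_psi_add_psi_add_psi n
  have h₃ (k : ℝ) (hk : k ≤ 1 / 2) : ψ ((n : ℝ) ^ k) ≤ ψ (√n) := by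
    rw [Real.sqrt_eq_rpow]
    exact Chebyshev.psi_mono (Real.rpow_le_rpow_of_exponent_le hn1 hk)
  have h₄ := psi_le_add_log_sq' (Real.one_le_sqrt.2 hn1)
  rw [Real.log_sqrt (by positivity)] at h₄
  linarith [h₃ (2 : ℝ)⁻¹ (by norm_num), h₃ (3 : ℝ)⁻¹ (by norm_num), h₃ (5 : ℝ)⁻¹ (by norm_num)]

theorem three_mul_primeCounting_half_lt_of_ge {p : ℕ} (hp : 131072 ≤ p) :
    3 * π (p / 2) < 2 * π p := by
  have hp' : (131072 : ℝ) ≤ p := mod_cast hp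
  set y : ℝ := p / 2 with hy
  have hpy : (p : ℝ) = 2 * y := by linarith
  have hy' : 65536 ≤ y := by linarith
  have hfloor : ⌊y⌋₊ = p / 2 := by
    rw [hy, Nat.floor_div_ofNat, Nat.floor_natCast]
  have a₂ := Real.log_two_gt_d9
  have b₂ := Real.log_two_lt_d9
  set l := Real.log y with hl
  have hlp : Real.log p = l + Real.log 2 := by
    rw [hpy, Real.log_mul (by norm_num) (by positivity), add_comm]
  have l65536 : Real.log 65536 = 16 * Real.log 2 := by
    rw [show (65536 : ℝ) = 2 ^ 16 by norm_num, Real.log_pow]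
    norm_num
  have l256 : Real.log 256 = 8 * Real.log 2 := by
    rw [show (256 : ℝ) = 2 ^ 8 by norm_num, Real.log_pow]
    norm_num
  have hl11 : 11.09 ≤ l := by
    have := Real.log_le_log (by norm_num) hy'
    linarith
  have hs : 256 ≤ √y := Real.le_sqrt_of_sq_le (by norm_num; exact hy')
  have hss : √y ^ 2 = y := Real.sq_sqrt (by linarith)
  have hlog : l ≤ 2 * (√y / 256 + 8 * Real.log 2 - 1) := by
    have h := Real.log_le_sub_one_of_pos (x := √y / 256) (by positivity)
    rw [Real.log_div (by positivity) (by norm_num), Real.log_sqrt (by linarith), l256] at h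
    linarith
  have hlog' : l ≤ 0.04334 * √y := by linarith
  have hl2 : l ^ 2 ≤ 0.00188 * y := by
    nlinarith
  have hl1 : l ≤ 0.00017 * y := by nlinarith
  have hsp : √(p : ℝ) ≤ 0.00553 * y := by
    rw [Real.sqrt_le_left (by positivity), hpy]
    nlinarith
  have h₁ := primeCounting_floor_mul_log_le (x := y) (by linarith)
  rw [hfloor, ← hl] at h₁
  have h₂ := theta_sub_theta_half_le p
  have h₃ := le_theta (n := p) (by omega)
  have h₄ : θ (p / 2 : ℕ) ≤ 1.1057 * y + l ^ 2 := by
    rw [← hfloor, ← Chebyshev.theta_eq_theta_coe_floor]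
    exact (Chebyshev.theta_le_psi y).trans (psi_le_add_log_sq' (by linarith))
  rw [hlp] at h₂ h₃
  have h₅ : y / l ≤ 0.0902 * y := by
    rw [div_le_iff₀ (by linarith)]
    nlinarith
  have h₆ : π (p / 2) * l ≤ 1.29 * y := by linarith
  have h₇ : 1.41 * y ≤ 2 * ((π p : ℝ) - π (p / 2)) * (l + Real.log 2) := by
    have : (l + Real.log 2) ^ 2 ≤ 1.15 * l ^ 2 := by nlinarith
    linarith
  have h₈ : (π (p / 2) : ℝ) < 2 * ((π p : ℝ) - π (p / 2)) := by
    by_contra! h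
    have h₉ : 2 * ((π p : ℝ) - π (p / 2)) * (l + Real.log 2) ≤ π (p / 2) * (1.065 * l) := by
      gcongr
      linarith
    linarith
  have : (3 * π (p / 2) : ℝ) < 2 * π p := by linarith
  exact_mod_cast this

theorem three_mul_primeCounting_half_lt {p : ℕ} (hp : p.Prime) : 3 * π (p / 2) < 2 * π p :=
  (lt_or_ge p 131072).elim (three_mul_primeCounting_half_lt_of_lt hp)
    three_mul_primeCounting_half_lt_of_ge

theorem pi_nthPrime_three_n (n : ℕ) (hn : 0 < n) :
    n < (nthPrime (3 * n)).primeCounting - (nthPrime (3 * n) / 2).primeCounting := by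
  have hp : (nthPrime (3 * n)).Prime := Nat.prime_nth_prime _
  have hcount : π (nthPrime (3 * n)) = 3 * n := by
    have h : π' (nthPrime (3 * n)) = 3 * n - 1 := Nat.primeCounting'_nth_eq _
    rw [Nat.primeCounting, Nat.primeCounting', Nat.count_succ, if_pos hp, ← Nat.primeCounting', h]
    omega
  have := three_mul_primeCounting_half_lt hp
  omega
end

section
/- For every positive integer n, the n-th Ramanujan prime satisfies R_n < p_{3n}, where p_k denotes the k-th prime number. -/
open ArithmeticFunction in
theorem log_factorial_div_eq_sum (N k : ℕ) :
    Real.log (N / k).factorial =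
      ∑ d ∈ Finset.Ioc 0 N, vonMangoldt d * ((N / d / k : ℕ) : ℝ) := by
  have h (m : ℕ) : Real.log m.factorial =
      ∑ d ∈ Finset.Ioc 0 m, vonMangoldt d * ((m / d : ℕ) : ℝ) := by
    rw [← sum_Ioc_mul_zeta_eq_sum, vonMangoldt_mul_zeta]
    induction m with
    | zero => simp
    | succ m ih =>
      rw [Nat.factorial_succ, Nat.cast_mul, Real.log_mul (by positivity) (by positivity), ih,
        Finset.sum_Ioc_succ_top (Nat.zero_le m), log_apply, add_comm]
  rw [h]
  refine Finset.sum_subset_zero_on_sdiff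
    (Finset.Ioc_subset_Ioc_right (Nat.div_le_self N k)) (fun d hd ↦ ?_) fun d _ ↦ ?_
  · simp only [Finset.mem_sdiff, Finset.mem_Ioc, not_and, not_le] at hd
    have : N / d / k = 0 := by
      rw [Nat.div_div_eq_div_mul, mul_comm, ← Nat.div_div_eq_div_mul]
      exact Nat.div_eq_of_lt (hd.2 hd.1.1)
    simp [this]
  · rw [Nat.div_div_eq_div_mul, Nat.div_div_eq_div_mul, mul_comm k d]

/-- The logarithm of Chebyshev's quotient `N! ⌊N/30⌋! / (⌊N/2⌋! ⌊N/3⌋! ⌊N/5⌋!)`. -/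
noncomputable def logChebyshevQuotient (N : ℕ) : ℝ :=
  Real.log N.factorial - Real.log (N / 2).factorial - Real.log (N / 3).factorial -
    Real.log (N / 5).factorial + Real.log (N / 30).factorial

theorem logChebyshevQuotient_eq_sum (N : ℕ) :
    logChebyshevQuotient N = ∑ d ∈ Finset.Ioc 0 N, ArithmeticFunction.vonMangoldt d *
      ((N / d : ℕ) - (N / d / 2 : ℕ) - (N / d / 3 : ℕ) - (N / d / 5 : ℕ) + (N / d / 30 : ℕ)) := by
  have h := log_factorial_div_eq_sum N 1
  simp only [Nat.div_one] at h
  rw [logChebyshevQuotient, h, log_factorial_div_eq_sum N 2,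
    log_factorial_div_eq_sum N 3, log_factorial_div_eq_sum N 5,
    log_factorial_div_eq_sum N 30]
  simp only [mul_sub, mul_add, Finset.sum_sub_distrib, Finset.sum_add_distrib]

theorem logChebyshevQuotient_le_psi (N : ℕ) : logChebyshevQuotient N ≤ Chebyshev.psi N := by
  rw [logChebyshevQuotient_eq_sum, Chebyshev.psi, Nat.floor_natCast]
  refine Finset.sum_le_sum fun d _ ↦
    mul_le_of_le_one_right ArithmeticFunction.vonMangoldt_nonneg ?_
  have : N / d + N / d / 30 ≤ 1 + N / d / 2 + N / d / 3 + N / d / 5 := by omega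
  have : ((N / d : ℕ) : ℝ) + (N / d / 30 : ℕ) ≤
      1 + (N / d / 2 : ℕ) + (N / d / 3 : ℕ) + (N / d / 5 : ℕ) := mod_cast this
  linarith

theorem psi_sub_psi_div_six_le_s19 (N : ℕ) :
    Chebyshev.psi N - Chebyshev.psi (N / 6 : ℕ) ≤ logChebyshevQuotient N := by
  rw [logChebyshevQuotient_eq_sum, Chebyshev.psi, Chebyshev.psi, Nat.floor_natCast,
    Nat.floor_natCast, ← Finset.sum_sdiff (Finset.Ioc_subset_Ioc_right (Nat.div_le_self N 6)),
    add_sub_cancel_right]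
  have key (d : ℕ) : N / d / 2 + N / d / 3 + N / d / 5 ≤ N / d + N / d / 30 := by omega
  refine (Finset.sum_le_sum fun d hd ↦ ?_).trans
    (Finset.sum_le_sum_of_subset_of_nonneg Finset.sdiff_subset fun d _ _ ↦ ?_)
  · refine le_mul_of_one_le_right ArithmeticFunction.vonMangoldt_nonneg ?_
    simp only [Finset.mem_sdiff, Finset.mem_Ioc, not_and, not_le] at hd
    have h1 : 1 ≤ N / d := (Nat.one_le_div_iff hd.1.1).2 hd.1.2
    have h6 : N / d < 6 := by
      rw [Nat.div_lt_iff_lt_mul hd.1.1, mul_comm]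
      exact (Nat.div_lt_iff_lt_mul (by norm_num)).1 (hd.2 hd.1.1)
    have : 1 + N / d / 2 + N / d / 3 + N / d / 5 ≤ N / d + N / d / 30 := by omega
    have : 1 + ((N / d / 2 : ℕ) : ℝ) + (N / d / 3 : ℕ) + (N / d / 5 : ℕ) ≤
      (N / d : ℕ) + (N / d / 30 : ℕ) := mod_cast this
    linarith
  · refine mul_nonneg ArithmeticFunction.vonMangoldt_nonneg ?_
    have : ((N / d / 2 : ℕ) : ℝ) + (N / d / 3 : ℕ) + (N / d / 5 : ℕ) ≤
      (N / d : ℕ) + (N / d / 30 : ℕ) := mod_cast key d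
    linarith

theorem log_add_one_sub_log_le {x : ℝ} (hx : 0 < x) : Real.log (x + 1) - Real.log x ≤ 1 / x := by
  rw [← Real.log_div (by positivity) hx.ne']
  refine (Real.log_le_sub_one_of_pos (by positivity)).trans_eq ?_
  field_simp
  ring

theorem one_div_add_one_le_log_sub {x : ℝ} (hx : 0 < x) :
    1 / (x + 1) ≤ Real.log (x + 1) - Real.log x := by
  rw [← Real.log_div (by positivity) hx.ne']
  refine Eq.trans_le ?_ (Real.one_sub_inv_le_log_of_pos (by positivity))
  field_simp
  ring

theorem log_factorial_bounds {n : ℕ} (hn : 1 ≤ n) :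
    n * Real.log n - n + 1 ≤ Real.log n.factorial ∧
      Real.log n.factorial ≤ n * Real.log n - n + 1 + Real.log n := by
  induction n, hn using Nat.le_induction with
  | base => simp
  | succ n hn ih =>
    have h0 : (0 : ℝ) < n := by exact_mod_cast hn
    rw [Nat.factorial_succ, Nat.cast_mul, Real.log_mul (by positivity) (by positivity)]
    push_cast
    have h1 := log_add_one_sub_log_le h0
    have h2 := one_div_add_one_le_log_sub h0
    rw [le_div_iff₀ h0] at h1
    rw [div_le_iff₀ (by positivity)] at h2
    constructor <;> nlinarith

theorem mul_log_sub_self_mono {s t : ℝ} (hs : 1 ≤ s) (hst : s ≤ t) :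
    s * Real.log s - s ≤ t * Real.log t - t := by
  have hs0 : 0 < s := by linarith
  have ht0 : 0 < t := by linarith
  have h := Real.one_sub_inv_le_log_of_pos (div_pos ht0 hs0)
  rw [Real.log_div ht0.ne' hs0.ne', inv_div] at h
  have h' : t - s ≤ t * (Real.log t - Real.log s) := by
    calc t - s = t * (1 - s / t) := by field_simp
      _ ≤ _ := by gcongr
  have := mul_nonneg (sub_nonneg.2 hst) (Real.log_nonneg hs)
  nlinarith

theorem log_factorial_floor_bounds {t : ℝ} (ht : 1 ≤ t) :
    t * Real.log t - t - Real.log t ≤ Real.log (⌊t⌋₊).factorial ∧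
      Real.log (⌊t⌋₊).factorial ≤ t * Real.log t - t + 1 + Real.log t := by
  set n := ⌊t⌋₊ with hn
  have hn1 : 1 ≤ n := Nat.one_le_floor_iff _ |>.2 ht
  have hnt : (n : ℝ) ≤ t := Nat.floor_le (by linarith)
  have htn : t ≤ (n + 1 : ℕ) := by exact_mod_cast (Nat.lt_floor_add_one t).le
  have h1 : (1 : ℝ) ≤ n := mod_cast hn1
  constructor
  · have h := (log_factorial_bounds (n := n + 1) (by omega)).1
    rw [Nat.factorial_succ, Nat.cast_mul, Real.log_mul (by positivity) (by positivity)] at h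
    have hm := mul_log_sub_self_mono ht htn
    have hl : Real.log (n + 1 : ℕ) ≤ Real.log t + 1 := by
      have := log_add_one_sub_log_le (x := n) (by linarith)
      have h2 : 1 / (n : ℝ) ≤ 1 := by
        rw [div_le_one] <;> linarith
      have := Real.log_le_log (by linarith) hnt
      push_cast
      linarith
    linarith
  · have := (log_factorial_bounds hn1).2
    have := mul_log_sub_self_mono h1 hnt
    have := Real.log_le_log (by linarith) hnt
    linarith

theorem log_factorial_div_bounds {N k : ℕ} (hk : 0 < k) (hkN : k ≤ N) :
    N / k * (Real.log N - Real.log k) - N / k - (Real.log N - Real.log k) ≤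
        Real.log (N / k).factorial ∧
      Real.log (N / k).factorial ≤
        N / k * (Real.log N - Real.log k) - N / k + 1 + (Real.log N - Real.log k) := by
  have hk0 : (0 : ℝ) < k := mod_cast hk
  have h := log_factorial_floor_bounds (t := (N : ℝ) / k)
    ((one_le_div hk0).2 (mod_cast hkN))
  rwa [Nat.floor_div_eq_div, Real.log_div (Nat.cast_ne_zero.2 (by omega)) hk0.ne'] at h

theorem logChebyshevQuotient_bounds {N : ℕ} (hN : 30 ≤ N) :
    0.92129 * N - 5 * Real.log N ≤ logChebyshevQuotient N ∧
      logChebyshevQuotient N ≤ 0.9213 * N + 5 * Real.log N - 4 := by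
  have h1 := log_factorial_div_bounds (N := N) one_pos (by omega)
  have h2 := log_factorial_div_bounds (N := N) two_pos (by omega)
  have h3 := log_factorial_div_bounds (N := N) three_pos (by omega)
  have h5 := log_factorial_div_bounds (N := N) (k := 5) (by norm_num) (by omega)
  have h30 := log_factorial_div_bounds (N := N) (k := 30) (by norm_num) (by omega)
  have hl : Real.log (30 : ℕ) = Real.log 2 + Real.log 3 + Real.log 5 := by
    rw [← Real.log_mul (by norm_num) (by norm_num), ← Real.log_mul (by norm_num) (by norm_num)]
    norm_num
  rw [hl] at h30
  simp only [Nat.div_one, Nat.cast_one, Real.log_one, Nat.cast_ofNat] at h1 h2 h3 h5 h30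
  have hN0 : (0 : ℝ) ≤ N := N.cast_nonneg
  have a2 := Real.log_two_gt_d9
  have b2 := Real.log_two_lt_d9
  have a3 := Real.log_three_gt_d9
  have b3 := Real.log_three_lt_d9
  have a5 := Real.log_five_gt_d9
  have b5 := Real.log_five_lt_d9
  have m2 := mul_le_mul_of_nonneg_left a2.le hN0
  have n2 := mul_le_mul_of_nonneg_left b2.le hN0
  have m3 := mul_le_mul_of_nonneg_left a3.le hN0
  have n3 := mul_le_mul_of_nonneg_left b3.le hN0
  have m5 := mul_le_mul_of_nonneg_left a5.le hN0
  have n5 := mul_le_mul_of_nonneg_left b5.le hN0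
  unfold logChebyshevQuotient
  ring_nf at h1 h2 h3 h5 h30 m2 n2 m3 n3 m5 n5 ⊢
  constructor <;> linarith

/-- Checks `l ≤ 3 ^ n`, `lcm (l, n + 1) ≤ 3 ^ (n + 1)`, …, for `k` consecutive exponents. -/
def lcmSweep : ℕ → ℕ → ℕ → Bool
  | 0, _, _ => true
  | k + 1, n, l => l.ble (3 ^ n) && lcmSweep k (n + 1) (l.lcm (n + 1))

theorem lcmUpto_le_three_pow_of_lcmSweep {k n : ℕ} (h : lcmSweep k n n.lcmUpto = true) {m : ℕ}
    (hn : n ≤ m) (hm : m < n + k) : m.lcmUpto ≤ 3 ^ m := by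
  induction k generalizing n with
  | zero => omega
  | succ k ih =>
    simp only [lcmSweep, Bool.and_eq_true, Nat.ble_eq] at h
    rcases hn.eq_or_lt with rfl | hlt
    · exact h.1
    · have hs : (n + 1).lcmUpto = n.lcmUpto.lcm (n + 1) := by
        rw [Nat.lcmUpto, ← Finset.insert_Icc_right_eq_Icc_add_one (by omega), Finset.lcm_insert,
          lcm_comm]
        rfl
      exact ih (hs ▸ h.2) hlt (by omega)

theorem lcmUpto_le_three_pow {m : ℕ} (hm : m ≤ 3200) : m.lcmUpto ≤ 3 ^ m := by
  have h : lcmSweep 3201 0 1 = true := by decide +kernel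
  exact lcmUpto_le_three_pow_of_lcmSweep (k := 3201) (n := 0) (by simpa [Nat.lcmUpto] using h)
    (Nat.zero_le m) (by omega)

theorem log_le_log_add_div_sub_one {x a : ℝ} (ha : 0 < a) (hx : 0 < x) :
    Real.log x ≤ Real.log a + (x / a - 1) := by
  have := Real.log_le_sub_one_of_pos (div_pos hx ha)
  rw [Real.log_div hx.ne' ha.ne'] at this
  linarith

theorem psi_natCast_le (N : ℕ) : Chebyshev.psi N ≤ 1.12 * N := by
  induction N using Nat.strong_induction_on with
  | _ N ih =>
    rcases le_or_gt N 3200 with hN | hN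
    · rw [Chebyshev.psi_eq_log_lcmUpto]
      have h : Real.log (N.lcmUpto) ≤ Real.log (3 ^ N) :=
        Real.log_le_log (mod_cast N.lcmUpto_pos) (mod_cast lcmUpto_le_three_pow hN)
      rw [Real.log_pow] at h
      have := mul_le_mul_of_nonneg_left Real.log_three_lt_d9.le (N.cast_nonneg (α := ℝ))
      have := N.cast_nonneg (α := ℝ)
      linarith
    · have h1 := psi_sub_psi_div_six_le_s19 N
      have h2 := (logChebyshevQuotient_bounds (N := N) (by omega)).2
      have h3 := ih (N / 6) (by omega)
      have h4 : ((N / 6 : ℕ) : ℝ) ≤ N / 6 := Nat.cast_div_le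
      have hNr : (3200 : ℝ) < N := mod_cast hN
      have h5 := log_le_log_add_div_sub_one (x := N) (a := 3200) (by norm_num) (by linarith)
      have h6 : Real.log 3200 = 7 * Real.log 2 + 2 * Real.log 5 := by
        rw [show (3200 : ℝ) = 2 ^ 7 * 5 ^ 2 by norm_num,
          Real.log_mul (by norm_num) (by norm_num), Real.log_pow, Real.log_pow]
        norm_num
      have := Real.log_two_lt_d9
      have := Real.log_five_lt_d9
      linarith

theorem psi_le_mul {x : ℝ} (hx : 0 ≤ x) : Chebyshev.psi x ≤ 1.12 * x := by
  rw [Chebyshev.psi_eq_psi_coe_floor]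
  refine (psi_natCast_le _).trans ?_
  gcongr
  exact Nat.floor_le hx

theorem primeCounting_succ (n : ℕ) :
    (n + 1).primeCounting = n.primeCounting + if (n + 1).Prime then 1 else 0 :=
  Nat.count_succ _ _

theorem theta_natCast_succ (n : ℕ) :
    Chebyshev.theta (n + 1 : ℕ) =
      Chebyshev.theta n + if (n + 1).Prime then Real.log (n + 1 : ℕ) else 0 := by
  simp only [Chebyshev.theta, Nat.floor_natCast, Finset.sum_filter]
  rw [Finset.sum_Ioc_succ_top (Nat.zero_le n)]

theorem theta_sub_theta_le {y x : ℕ} (hyx : y ≤ x) :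
    Chebyshev.theta x - Chebyshev.theta y ≤
      (x.primeCounting - y.primeCounting) * Real.log x := by
  induction x, hyx using Nat.le_induction with
  | base => simp
  | succ x hx ih =>
    rw [theta_natCast_succ, primeCounting_succ]
    have hlog : Real.log x ≤ Real.log (x + 1 : ℕ) := by
      rcases x.eq_zero_or_pos with rfl | h0
      · simp
      · exact Real.log_le_log (mod_cast h0) (mod_cast x.le_succ)
    have hpi : (y.primeCounting : ℝ) ≤ x.primeCounting :=
      mod_cast Nat.monotone_primeCounting hx
    have := mul_le_mul_of_nonneg_left hlog (sub_nonneg.2 hpi)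
    split_ifs <;> push_cast at * <;> linarith

theorem log_four_hundred_gt : 5.9914 < Real.log 400 := by
  rw [show (400 : ℝ) = 2 ^ 4 * 5 ^ 2 by norm_num, Real.log_mul (by norm_num) (by norm_num),
    Real.log_pow, Real.log_pow]
  have := Real.log_two_gt_d9
  have := Real.log_five_gt_d9
  push_cast
  linarith

theorem primeCounting_le_theta_div_log_add {n : ℕ} (hn : 400 ≤ n) :
    (n.primeCounting : ℝ) ≤
      Chebyshev.theta n / Real.log n + 1.7 * (n / Real.log n ^ 2) + 78 := by
  induction n, hn using Nat.le_induction with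
  | base =>
    have : Nat.primeCounting 400 = 78 := by decide +kernel
    rw [this]
    have := Chebyshev.theta_nonneg (400 : ℕ)
    have : 0 ≤ Real.log (400 : ℕ) := Real.log_natCast_nonneg _
    have : 0 ≤ Chebyshev.theta (400 : ℕ) / Real.log (400 : ℕ) := by positivity
    have : 0 ≤ 1.7 * (((400 : ℕ) : ℝ) / Real.log (400 : ℕ) ^ 2) := by positivity
    push_cast at *
    linarith
  | succ n hn ih =>
    have hnr : (400 : ℝ) ≤ n := mod_cast hn
    have hn0 : (0 : ℝ) < n := by linarith
    have hab := log_add_one_sub_log_le hn0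
    have ha := log_four_hundred_gt.trans_le (Real.log_le_log (by norm_num) hnr)
    have hab' : Real.log n ≤ Real.log (n + 1) := Real.log_le_log hn0 (by linarith)
    have hθ := (Chebyshev.theta_le_psi n).trans (psi_natCast_le n)
    have hθ0 := Chebyshev.theta_nonneg n
    rw [theta_natCast_succ, primeCounting_succ]
    push_cast
    set a := Real.log n
    set b := Real.log (n + 1 : ℝ)
    have ha0 : 0 < a := by linarith
    have hb0 : 0 < b := by linarith
    have hnab : n * (b - a) ≤ 1 := by
      rw [le_div_iff₀ hn0] at hab
      linarith
    have hθinc : Chebyshev.theta n / a - Chebyshev.theta n / b ≤ 1.12 / (a * b) := by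
      calc Chebyshev.theta n / a - Chebyshev.theta n / b
          = Chebyshev.theta n * (b - a) / (a * b) := by field_simp
        _ ≤ 1.12 / (a * b) := by
          gcongr
          nlinarith [mul_le_mul_of_nonneg_right hθ (sub_nonneg.2 hab')]
    have hmain : 1.12 / (a * b) ≤ 1.7 * ((n + 1) / b ^ 2) - 1.7 * (n / a ^ 2) := by
      have hb : b ≤ a + 1 / 400 := by
        have : 1 / (n : ℝ) ≤ 1 / 400 := by gcongr
        linarith
      have e : 1.7 * ((n + 1) / b ^ 2) - 1.7 * (n / a ^ 2) - 1.12 / (a * b) =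
          (1.7 * (a ^ 2 - n * (b - a) * (a + b)) - 1.12 * (a * b)) / (a ^ 2 * b ^ 2) := by
        field_simp
        ring
      rw [← sub_nonneg, e]
      refine div_nonneg ?_ (by positivity)
      have := mul_le_mul_of_nonneg_right hnab (add_pos ha0 hb0).le
      nlinarith [mul_le_mul_of_nonneg_left hb ha0.le]
    split_ifs
    · rw [add_div, div_self hb0.ne']
      linarith
    · simp only [add_zero]
      linarith

theorem theta_natCast_ge {x : ℕ} (hx : 30 ≤ x) :
    0.92129 * x - 5 * Real.log x - 3.36 * √x ≤ Chebyshev.theta x := by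
  have h1 := (logChebyshevQuotient_bounds hx).1.trans (logChebyshevQuotient_le_psi x)
  have h2 := Chebyshev.psi_sub_theta_le_psi_add_psi_add_psi x
  have hx1 : (1 : ℝ) ≤ x := mod_cast (by omega : 1 ≤ x)
  have h (r : ℝ) (hr : r ≤ 2⁻¹) : Chebyshev.psi ((x : ℝ) ^ r) ≤ 1.12 * √x := by
    refine (psi_le_mul (by positivity)).trans ?_
    rw [Real.sqrt_eq_rpow, one_div]
    gcongr
  linarith [h 2⁻¹ le_rfl, h 3⁻¹ (by norm_num), h 5⁻¹ (by norm_num)]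

theorem three_mul_primeCounting_le_of_large {x y : ℕ} (hy : 40960 ≤ y) (hyx : 2 * y ≤ x)
    (hxy : x ≤ 2 * y + 1) : 3 * y.primeCounting ≤ 2 * x.primeCounting + 1 := by
  have hyr : (40960 : ℝ) ≤ y := mod_cast hy
  have hy0 : (0 : ℝ) < y := by linarith
  have hyxr : 2 * (y : ℝ) ≤ x := mod_cast hyx
  have hxyr : (x : ℝ) ≤ 2 * y + 1 := mod_cast hxy
  have hl2 := Real.log_two_gt_d9
  have hl2' := Real.log_two_lt_d9
  have hl5 := Real.log_five_gt_d9
  have hl5' := Real.log_five_lt_d9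
  have hlog : Real.log 40960 = 13 * Real.log 2 + Real.log 5 := by
    rw [show (40960 : ℝ) = 2 ^ 13 * 5 by norm_num,
      Real.log_mul (by norm_num) (by norm_num), Real.log_pow]
    norm_num
  have hLy := Real.log_le_log (by norm_num) hyr
  have hLx : Real.log x ≤ Real.log y + 0.694 := by
    have h := log_le_log_add_div_sub_one (x := x) (a := 2 * y) (by positivity) (by linarith)
    rw [Real.log_mul (by norm_num) hy0.ne'] at h
    have : (x : ℝ) / (2 * y) ≤ 1 + 1 / 80000 := by
      rw [div_le_iff₀ (by positivity)]
      linarith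
    linarith
  have hLy' := log_le_log_add_div_sub_one (x := y) (a := 40960) (by norm_num) hy0
  have hsqrt : √x ≤ x / 286 := by
    rw [Real.sqrt_le_left (by positivity)]
    nlinarith
  have hθx := theta_natCast_ge (x := x) (by omega)
  have hθy := (Chebyshev.theta_le_psi y).trans (psi_natCast_le y)
  have hdiff := theta_sub_theta_le (y := y) (x := x) (by omega)
  have hpi := primeCounting_le_theta_div_log_add (n := y) (by omega)
  set a := Real.log y
  set b := Real.log x
  have ha : 10.62 ≤ a := by linarith
  have hb0 : 0 < b := Real.log_pos (by linarith)
  have hpi' : (y.primeCounting : ℝ) ≤ 1.2802 * y / a + 78 := by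
    refine hpi.trans ?_
    have : Chebyshev.theta y / a + 1.7 * (y / a ^ 2) = (Chebyshev.theta y + 1.7 * y / a) / a := by
      field_simp
    rw [this]
    have : 1.7 * y / a ≤ 0.1602 * y := by
      rw [div_le_iff₀ (by linarith)]
      nlinarith
    gcongr
    linarith
  have hba : b / a ≤ 1.0654 := by
    rw [div_le_iff₀ (by linarith)]
    linarith
  have hpib : y.primeCounting * b ≤ 1.0654 * (1.2802 * y) + 78 * b := by
    calc y.primeCounting * b ≤ (1.2802 * y / a + 78) * b := by gcongr
      _ = (b / a) * (1.2802 * y) + 78 * b := by ring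
      _ ≤ _ := by gcongr
  have : (3 * y.primeCounting : ℝ) * b ≤ (2 * x.primeCounting) * b := by linarith
  have : (3 * y.primeCounting : ℝ) ≤ 2 * x.primeCounting := le_of_mul_le_mul_right this hb0
  have : 3 * y.primeCounting ≤ 2 * x.primeCounting := mod_cast this
  omega

theorem coprime_factorial_iff_prime {n s : ℕ} (hn : 2 ≤ n) (hsn : s < n)
    (hns : n < (s + 1) ^ 2) : n.Coprime s.factorial ↔ n.Prime := by
  refine ⟨fun h ↦ ?_, fun h ↦ ?_⟩
  · by_contra hp
    have hsq := Nat.minFac_sq_le_self (by omega) hp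
    have hle : n.minFac ≤ s := by
      have := lt_of_pow_lt_pow_left₀ 2 (Nat.zero_le _) (hsq.trans_lt hns)
      omega
    have hd : n.minFac ∣ n.gcd s.factorial :=
      Nat.dvd_gcd n.minFac_dvd (Nat.dvd_factorial n.minFac_pos hle)
    rw [h, Nat.dvd_one, Nat.minFac_eq_one_iff] at hd
    omega
  · rw [h.coprime_iff_not_dvd, h.dvd_factorial]
    omega

/-- A primality test, correct for `2 ≤ n ≤ 90000`, that is fast in the kernel. -/
def primeTest (n : ℕ) : Bool :=
  bif n.ble 300 then (n.gcd (n - 1).factorial).beq 1 else (n.gcd (Nat.factorial 300)).beq 1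

theorem primeTest_iff {n : ℕ} (hn : 2 ≤ n) (hn' : n ≤ 90000) :
    primeTest n = true ↔ n.Prime := by
  unfold primeTest
  rcases le_or_gt n 300 with h | h
  · rw [Nat.ble_eq_true_of_le h, cond_true, Nat.beq_eq]
    exact coprime_factorial_iff_prime hn (by omega)
      (by rw [Nat.sub_add_cancel (by omega)]; nlinarith)
  · rw [Bool.eq_false_iff.2 fun hle ↦ h.not_ge (Nat.le_of_ble_eq_true hle), cond_false, Nat.beq_eq]
    exact coprime_factorial_iff_prime hn h (by omega)

/-- The number of `n` with `a ≤ n < a + 2 ^ k` that pass `primeTest`. -/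
def countBlock (a : ℕ) : ℕ → ℕ
  | 0 => bif primeTest a then 1 else 0
  | k + 1 => countBlock a k + countBlock (a + 2 ^ k) k

theorem primeCounting'_add_countBlock {a k : ℕ} (ha : 2 ≤ a) (hak : a + 2 ^ k ≤ 90000) :
    a.primeCounting' + countBlock a k = (a + 2 ^ k).primeCounting' := by
  induction k generalizing a with
  | zero =>
    rw [pow_zero, Nat.primeCounting', Nat.count_succ, countBlock]
    by_cases h : a.Prime
    · simp [h, (primeTest_iff ha (by omega)).2 h]
    · simp [h, Bool.eq_false_iff.2 (h ∘ (primeTest_iff ha (by omega)).1)]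
  | succ k ih =>
    rw [pow_succ] at hak
    rw [countBlock, ← add_assoc, ih ha (by omega), ih (by omega) (by omega), add_assoc, ← two_mul,
      ← pow_succ']

/-- Given `c` and `d`, the number of primes below `a` and below `2 * a`, checks a list of triples
`(k, c', d')`, where `c'` and `d'` are the same counts with `a` replaced by `a + 2 ^ k`, and so
on, and checks `3 * c' ≤ 2 * d + 1` in every step. -/
def sweep : ℕ → ℕ → ℕ → List (ℕ × ℕ × ℕ) → Bool
  | _, _, _, [] => true
  | a, c, d, (k, c', d') :: l =>
    c'.beq (c + countBlock a k) && d'.beq (d + countBlock (2 * a) (k + 1)) &&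
      (3 * c').ble (2 * d + 1) && sweep (a + 2 ^ k) c' d' l

theorem three_mul_primeCounting_le_of_sweep {l : List (ℕ × ℕ × ℕ)} {a : ℕ} (ha : 2 ≤ a)
    (h : sweep a a.primeCounting' (2 * a).primeCounting' l = true)
    (hl : 2 * (a + (l.map (2 ^ ·.1)).sum) ≤ 90000) {m : ℕ} (ham : a ≤ m)
    (hm : m < a + (l.map (2 ^ ·.1)).sum) :
    3 * m.primeCounting ≤ 2 * (2 * m).primeCounting + 1 := by
  induction l generalizing a with
  | nil => simp at hm; omega
  | cons t l ih =>
    obtain ⟨k, c, d⟩ := t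
    simp only [List.map_cons, List.sum_cons] at hl hm
    simp only [sweep, Bool.and_eq_true, Nat.beq_eq, Nat.ble_eq] at h
    obtain ⟨⟨⟨hc, hd⟩, hcd⟩, h⟩ := h
    rw [primeCounting'_add_countBlock ha (by omega)] at hc
    rw [primeCounting'_add_countBlock (by omega) (by rw [pow_succ]; omega), pow_succ', ← mul_add]
      at hd
    rcases lt_or_ge m (a + 2 ^ k) with hlt | hge
    · have h1 : m.primeCounting ≤ c := hc ▸ Nat.monotone_primeCounting' hlt
      have h2 : (2 * a).primeCounting' ≤ (2 * m).primeCounting :=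
        Nat.monotone_primeCounting' (by omega)
      omega
    · exact ih (a := a + 2 ^ k) (ha.trans (Nat.le_add_right _ _)) (hc ▸ hd ▸ h) (by omega) hge
        (by omega)

theorem three_mul_primeCounting_le_of_small {m : ℕ} (hm : 2 ≤ m) (hm' : m < 40960) :
    3 * m.primeCounting ≤ 2 * (2 * m).primeCounting + 1 := by
  have h2 : Nat.primeCounting' 2 = 0 := by decide +kernel
  have h4 : Nat.primeCounting' (2 * 2) = 2 := by decide +kernel
  refine three_mul_primeCounting_le_of_sweep (a := 2) (l :=
    [(0, 1, 3), (1, 2, 4), (1, 3, 6), (2, 4, 8), (1, 5, 9), (2, 6, 11), (1, 7, 12), (2, 8, 14),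
      (2, 9, 16), (3, 11, 19), (3, 13, 23), (3, 15, 26), (3, 16, 30), (3, 18, 32), (3, 21, 35),
      (3, 22, 38), (4, 25, 45), (4, 30, 50), (4, 31, 55), (5, 37, 66), (5, 44, 77), (5, 48, 87),
      (5, 55, 97), (5, 61, 106), (6, 71, 127), (6, 80, 145), (6, 92, 162), (6, 100, 183),
      (7, 122, 217), (7, 139, 252), (7, 158, 284), (7, 177, 319), (7, 194, 351), (8, 228, 417),
      (8, 265, 478), (8, 297, 540), (8, 329, 601), (9, 397, 720), (9, 457, 839), (9, 522, 949),
      (9, 583, 1061), (10, 701, 1289), (10, 820, 1507), (10, 933, 1717), (10, 1046, 1933),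
      (11, 1274, 2342), (11, 1485, 2751), (11, 1698, 3153), (11, 1914, 3548), (12, 2327, 4323),
      (12, 2737, 5084), (12, 3139, 5841), (12, 3528, 6579), (13, 4302, 8044)])
    le_rfl ?_ (by decide) hm (hm'.trans_le (by decide))
  rw [h2, h4]
  decide +kernel

theorem three_mul_primeCounting_half_le (x : ℕ) :
    3 * (x / 2).primeCounting ≤ 2 * x.primeCounting + 1 := by
  rcases lt_or_ge (x / 2) 40960 with h | h
  · rcases lt_or_ge (x / 2) 2 with h2 | h2
    · rw [Nat.primeCounting_eq_zero_iff.2 (by omega)]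
      omega
    · have := three_mul_primeCounting_le_of_small h2 h
      have := Nat.monotone_primeCounting (by omega : 2 * (x / 2) ≤ x)
      omega
  · exact three_mul_primeCounting_le_of_large h (by omega) (by omega)

theorem ramanujan_lt_nthPrime (n : ℕ) (hn : 0 < n) : ramanujan n < nthPrime (3 * n) := by
  unfold nthPrime
  set p := Nat.nth Nat.Prime (3 * n - 1) with hp
  have hp2 : 3 * n - 1 + 2 ≤ p := Nat.add_two_le_nth_prime _
  suffices ramanujan n ≤ p - 1 by omega
  refine Nat.sInf_le ⟨by omega, fun x hx ↦ ?_⟩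
  have h1 := Nat.monotone_primeCounting hx
  rw [Nat.primeCounting_sub_one, hp, Nat.primeCounting'_nth_eq] at h1
  have h2 := three_mul_primeCounting_half_le x
  omega
end
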